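/- arXiv:2109.02759 — 10 statements merged into one kernel-verified Lean document; each statement's English description precedes it below -/
import Mathlib

section
/- Let (X,d) be a metric space, f : X → X a map, and x ∈ X. Then sα_f(x) = ⋃_t α(t), where the union is taken over all bitrajectories t of f based at x. -/
open Set Filter Topology

/-- A bitrajectory of `f` based at `x`: a full orbit `t : ℤ → X` with `t 0 = x`. -/
def IsBitraj {X : Type*} (f : X → X) (x : X) (t : ℤ → X) : Prop :=
  t 0 = x ∧ ∀ n : ℤ, f (t n) = t (n + 1)

/-- The set of backward limit points of a bitrajectory `t`. -/
def alphaTraj {X : Type*} [TopologicalSpace X] (t : ℤ → X) : Set X :=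
  {y | ∃ n : ℕ → ℕ, StrictMono n ∧ (∀ k, 0 < n k) ∧
    Tendsto (fun k => t (-(n k : ℤ))) atTop (𝓝 y)}

/-- The special α-limit set of `x` under `f`: all `y` that are limits of a sequence
`y_n` with `y_0 = x` and `f^[k n] (y n) = y (n-1)` for positive integers `k n`. -/
def sAlpha {X : Type*} [TopologicalSpace X] (f : X → X) (x : X) : Set X :=
  {y | ∃ (Y : ℕ → X) (k : ℕ → ℕ), Y 0 = x ∧
    (∀ n, 1 ≤ n → 1 ≤ k n ∧ f^[k n] (Y n) = Y (n - 1)) ∧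
    Tendsto Y atTop (𝓝 y)}

theorem IsBitraj.iterate {X : Type*} {f : X → X} {x : X} {t : ℤ → X} (ht : IsBitraj f x t)
    (z : ℤ) (k : ℕ) : f^[k] (t z) = t (z + k) := by
  induction k with
  | zero => simp
  | succ k ih =>
    rw [Function.iterate_succ_apply', ih, ht.2]
    push_cast
    rw [add_assoc]

/-- Backward limit points of a bitrajectory based at `x` belong to the special α-limit of `x`. -/
theorem IsBitraj.alphaTraj_subset {X : Type*} [TopologicalSpace X] {f : X → X} {x : X}
    {t : ℤ → X} (ht : IsBitraj f x t) : alphaTraj t ⊆ sAlpha f x := by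
  rintro y ⟨n, hn, hpos, hlim⟩
  obtain ⟨m, hm_zero, hm_succ⟩ : ∃ m : ℕ → ℕ, m 0 = 0 ∧ ∀ j, m (j + 1) = n j :=
    ⟨fun j => Nat.casesOn j 0 n, rfl, fun _ => rfl⟩
  have hm : StrictMono m := by
    refine strictMono_nat_of_lt_succ fun j => ?_
    cases j with
    | zero => simpa [hm_zero, hm_succ] using hpos 0
    | succ j => simpa only [hm_succ] using hn j.lt_succ_self
  refine ⟨fun j => t (-(m j : ℤ)), fun j => m j - m (j - 1), ?_, fun j hj => ?_, ?_⟩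
  · simpa [hm_zero] using ht.1
  · have hlt : m (j - 1) < m j := hm (by omega)
    refine ⟨Nat.sub_pos_of_lt hlt, ?_⟩
    rw [ht.iterate]
    congr 1
    dsimp only
    omega
  · refine (tendsto_add_atTop_iff_nat 1).1 ?_
    simpa only [hm_succ] using hlim

/-- In a backward chain `Y` with jumps `N (n + 1) - N n`, the forward orbits of all `Y n`
are pieces of one orbit. -/
theorem iterate_backward_chain {X : Type*} {f : X → X} {Y : ℕ → X} {N : ℕ → ℕ}
    (hN : Monotone N) (hY : ∀ n, f^[N (n + 1) - N n] (Y (n + 1)) = Y n)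
    {n m : ℕ} (hnm : n ≤ m) {a b : ℕ} (hab : a + N m = b + N n) :
    f^[b] (Y m) = f^[a] (Y n) := by
  induction m, hnm using Nat.le_induction generalizing b with
  | base =>
    obtain rfl : a = b := by omega
    rfl
  | succ m hnm ih =>
    have h₁ := hN hnm
    have h₂ := hN m.le_succ
    obtain ⟨c, rfl⟩ : ∃ c, b = c + (N (m + 1) - N m) := ⟨a + N m - N n, by grind⟩
    rw [Function.iterate_add_apply, hY]
    exact ih (by grind)

/-- A backward chain extends to a bitrajectory passing through all of its points. -/
theorem exists_isBitraj_of_backward_chain {X : Type*} {f : X → X} {Y : ℕ → X} {N : ℕ → ℕ}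
    (hN : StrictMono N) (hN0 : N 0 = 0) (hY : ∀ n, f^[N (n + 1) - N n] (Y (n + 1)) = Y n) :
    ∃ t, IsBitraj f (Y 0) t ∧ ∀ n, t (-(N n : ℤ)) = Y n := by
  have key := @iterate_backward_chain _ f Y N hN.monotone hY
  have le_N : ∀ n, n ≤ N n := fun _ => hN.le_apply
  let t : ℤ → X := fun z => f^[(z + N z.natAbs).toNat] (Y z.natAbs)
  have ht : ∀ (z : ℤ) (n a : ℕ), z + N n = a → t z = f^[a] (Y n) := by
    intro z n a hz
    have hz' := le_N z.natAbs
    rcases le_total n z.natAbs with h | h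
    · exact key h (by omega)
    · exact (key h (by omega)).symm
  have ht_N : ∀ n, t (-(N n : ℤ)) = Y n := fun n => ht _ n 0 (by omega)
  refine ⟨t, ⟨by simpa [hN0] using ht_N 0, fun z => ?_⟩, ht_N⟩
  have hz := le_N z.natAbs
  rw [ht (z + 1) z.natAbs ((z + N z.natAbs).toNat + 1) (by omega),
    Function.iterate_succ_apply']

/-- The special α-limit of `x` is the union, over all bitrajectories `t` of `f`
based at `x`, of the sets of backward limit points of `t`. -/
theorem sAlpha_eq_iUnion_alphaTraj {X : Type*} [MetricSpace X] (f : X → X) (x : X) :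
    sAlpha f x = ⋃ t ∈ {t : ℤ → X | IsBitraj f x t}, alphaTraj t := by
  refine Subset.antisymm ?_ (iUnion₂_subset fun t ht => IsBitraj.alphaTraj_subset ht)
  rintro y ⟨Y, k, rfl, hk, hlim⟩
  let N : ℕ → ℕ := fun n => ∑ i ∈ Finset.range n, k (i + 1)
  have hN_succ : ∀ n, N (n + 1) = N n + k (n + 1) := fun n => Finset.sum_range_succ _ n
  have hN : StrictMono N := strictMono_nat_of_lt_succ fun n => by
    have := (hk (n + 1) (by omega)).1
    have := hN_succ n
    omega
  obtain ⟨t, ht, ht_N⟩ := exists_isBitraj_of_backward_chain (f := f) (Y := Y) hN rfl fun n => by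
    rw [hN_succ, Nat.add_sub_cancel_left]
    exact (hk (n + 1) (by omega)).2
  refine mem_iUnion₂.2 ⟨t, ht, fun j => N (j + 1), fun i j hij => hN (by omega),
    fun j => (Nat.zero_le _).trans_lt (hN j.lt_succ_self), ?_⟩
  simp only [ht_N]
  exact (tendsto_add_atTop_iff_nat 1).2 hlim
end

section
/- Let (X,d) be a metric space, f : X → X continuous, and let t be a bitrajectory of f. Then every point of ω(t) is chain-recurrent and any two points of ω(t) are chain-equivalent; likewise every point of α(t) is chain-recurrent and any two points of α(t) are chain-equivalent. In other words, α(t) and ω(t) are each contained in a single node of f. -/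
open Set Filter Topology

/-- The set of forward limit points of a bitrajectory `t`. -/
def omegaTraj {X : Type*} [TopologicalSpace X] (t : ℤ → X) : Set X :=
  {y | ∃ n : ℕ → ℕ, StrictMono n ∧ (∀ k, 0 < n k) ∧
    Tendsto (fun k => t (n k : ℤ)) atTop (𝓝 y)}

/-- An ε-chain from `x` to `y` under `f`. -/
def EpsChain {X : Type*} [MetricSpace X] (f : X → X) (ε : ℝ) (x y : X) : Prop :=
  ∃ (n : ℕ) (cs : ℕ → X), cs 0 = x ∧ cs (n + 1) = y ∧
    ∀ i ≤ n, dist (f (cs i)) (cs (i + 1)) < ε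

/-- A point is chain-recurrent if there are ε-chains from it to itself for all ε > 0. -/
def ChainRec {X : Type*} [MetricSpace X] (f : X → X) (x : X) : Prop :=
  ∀ ε > 0, EpsChain f ε x x

/-- Two points are chain-equivalent if there are ε-chains in both directions for all ε > 0. -/
def ChainEquiv {X : Type*} [MetricSpace X] (f : X → X) (x y : X) : Prop :=
  ∀ ε > 0, EpsChain f ε x y ∧ EpsChain f ε y x

/-- A long enough orbit segment starting near `y` and ending near `z` can be adjusted at its
endpoints to an ε-chain from `y` to `z`. -/
theorem epsChain_of_orbit_segments {X : Type*} [MetricSpace X] {f : X → X} (hf : Continuous f)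
    {t : ℤ → X} (ht : ∀ n : ℤ, f (t n) = t (n + 1)) {y z : X}
    (h : ∀ δ > 0, ∃ a b : ℤ, a + 2 ≤ b ∧ dist (t a) y < δ ∧ dist (t b) z < δ)
    {ε : ℝ} (hε : 0 < ε) : EpsChain f ε y z := by
  obtain ⟨δ, hδ, hfδ⟩ := Metric.continuous_iff.mp hf y ε hε
  obtain ⟨a, b, hab, ha, hb⟩ := h (min δ ε) (lt_min hδ hε)
  obtain ⟨n, hn⟩ : ∃ n : ℕ, b = a + n + 2 := ⟨(b - a - 2).toNat, by omega⟩
  refine ⟨n + 1, fun i => if i = 0 then y else if i = n + 2 then z else t (a + i),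
    by simp, by simp, fun i hi => ?_⟩
  rcases Nat.eq_zero_or_pos i with rfl | hpos
  · have hy := hfδ (t a) (ha.trans_le (min_le_left _ _))
    rw [ht, dist_comm] at hy
    simpa using hy
  · have hi0 : i ≠ 0 := hpos.ne'
    have hin : i ≠ n + 2 := by omega
    rcases hi.eq_or_lt with rfl | hlt
    · have hb' : a + ((n + 1 : ℕ) : ℤ) + 1 = b := by push_cast; omega
      simp only [hi0, hin, if_false, ht, hb']
      simpa using hb.trans_le (min_le_right _ _)
    · have hin' : i + 1 ≠ n + 2 := by omega
      simp only [hi0, hin, hin', Nat.succ_ne_zero, if_false, ht]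
      simpa [add_assoc] using hε

/-- The trajectory visits every neighbourhood of a forward limit point at arbitrarily late times. -/
theorem exists_dist_lt_of_mem_omegaTraj {X : Type*} [MetricSpace X] {t : ℤ → X} {y : X}
    (hy : y ∈ omegaTraj t) (N : ℤ) {δ : ℝ} (hδ : 0 < δ) :
    ∃ a : ℤ, N ≤ a ∧ dist (t a) y < δ := by
  obtain ⟨n, hn, -, hlim⟩ := hy
  obtain ⟨k, hk, hN⟩ := ((Metric.tendsto_nhds.mp hlim δ hδ).and
    (hn.tendsto_atTop.eventually_ge_atTop N.toNat)).exists
  exact ⟨n k, by omega, hk⟩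

/-- The trajectory visits every neighbourhood of a backward limit point at arbitrarily early
times. -/
theorem exists_dist_lt_of_mem_alphaTraj {X : Type*} [MetricSpace X] {t : ℤ → X} {y : X}
    (hy : y ∈ alphaTraj t) (N : ℤ) {δ : ℝ} (hδ : 0 < δ) :
    ∃ a : ℤ, a ≤ N ∧ dist (t a) y < δ := by
  obtain ⟨n, hn, -, hlim⟩ := hy
  obtain ⟨k, hk, hN⟩ := ((Metric.tendsto_nhds.mp hlim δ hδ).and
    (hn.tendsto_atTop.eventually_ge_atTop (-N).toNat)).exists
  exact ⟨-n k, by omega, hk⟩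

/-- For a continuous map `f` and a bitrajectory `t`, all points of `ω(t)` are
chain-recurrent and mutually chain-equivalent, and likewise for `α(t)`: each of
`α(t)` and `ω(t)` is contained in a single node of `f`. -/
theorem omegaTraj_alphaTraj_in_single_node {X : Type*} [MetricSpace X]
    (f : X → X) (hf : Continuous f) (t : ℤ → X)
    (ht : ∀ n : ℤ, f (t n) = t (n + 1)) :
    ((∀ y ∈ omegaTraj t, ChainRec f y) ∧
      ∀ y ∈ omegaTraj t, ∀ z ∈ omegaTraj t, ChainEquiv f y z) ∧
    ((∀ y ∈ alphaTraj t, ChainRec f y) ∧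
      ∀ y ∈ alphaTraj t, ∀ z ∈ alphaTraj t, ChainEquiv f y z) := by
  have hω : ∀ y ∈ omegaTraj t, ∀ z ∈ omegaTraj t, ∀ ε > 0, EpsChain f ε y z := by
    intro y hy z hz ε hε
    refine epsChain_of_orbit_segments hf ht (fun δ hδ => ?_) hε
    obtain ⟨a, -, ha⟩ := exists_dist_lt_of_mem_omegaTraj hy 0 hδ
    obtain ⟨b, hab, hb⟩ := exists_dist_lt_of_mem_omegaTraj hz (a + 2) hδ
    exact ⟨a, b, hab, ha, hb⟩
  have hα : ∀ y ∈ alphaTraj t, ∀ z ∈ alphaTraj t, ∀ ε > 0, EpsChain f ε y z := by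
    intro y hy z hz ε hε
    refine epsChain_of_orbit_segments hf ht (fun δ hδ => ?_) hε
    obtain ⟨b, -, hb⟩ := exists_dist_lt_of_mem_alphaTraj hz 0 hδ
    obtain ⟨a, hab, ha⟩ := exists_dist_lt_of_mem_alphaTraj hy (b - 2) hδ
    exact ⟨a, b, by omega, ha, hb⟩
  exact ⟨⟨fun y hy => hω y hy y hy,
      fun y hy z hz ε hε => ⟨hω y hy z hz ε hε, hω z hz y hy ε hε⟩⟩,
    ⟨fun y hy => hα y hy y hy,
      fun y hy z hz ε hε => ⟨hα y hy z hz ε hε, hα z hz y hy ε hε⟩⟩⟩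
end

section
/- Let X be a compact metric space and f : X → X continuous, and let A and B be nodes of f. If there exists a bitrajectory t of f with α(t) ⊆ A and ω(t) ⊆ B, and also a bitrajectory t' of f with α(t') ⊆ B and ω(t') ⊆ A, then A = B. (The graph of a dynamical system has no loops.) -/
open Set Filter Topology

/-- A node of `f`: an equivalence class of the chain-equivalence relation
on the chain-recurrent set. -/
def IsNode {X : Type*} [MetricSpace X] (f : X → X) (N : Set X) : Prop :=
  ∃ x, ChainRec f x ∧ N = {y | ChainRec f y ∧ ChainEquiv f x y}

theorem epsChain_iff_transGen {X : Type*} [MetricSpace X] {f : X → X} {ε : ℝ} {x y : X} :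
    EpsChain f ε x y ↔ Relation.TransGen (fun u v => dist (f u) v < ε) x y := by
  constructor
  · rintro ⟨n, cs, rfl, rfl, h⟩
    induction n with
    | zero => exact .single (h 0 le_rfl)
    | succ n ih => exact (ih fun i hi => h i (by omega)).tail (h (n + 1) le_rfl)
  · intro h
    induction h with
    | @single b hb =>
      refine ⟨0, fun i => if i = 0 then x else b, by simp, by simp, fun i hi => ?_⟩
      obtain rfl : i = 0 := by omega
      simpa using hb
    | @tail b c _ hbc ih =>
      obtain ⟨n, cs, h0, hn, h⟩ := ih
      refine ⟨n + 1, fun i => if i ≤ n + 1 then cs i else c, by simp [h0], by simp,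
        fun i hi => ?_⟩
      rcases Nat.lt_or_ge n i with hlt | hle
      · obtain rfl : i = n + 1 := by omega
        simpa [hn] using hbc
      · have h₁ : i ≤ n + 1 := by omega
        simpa [h₁, hle] using h i hle

theorem EpsChain.trans {X : Type*} [MetricSpace X] {f : X → X} {ε : ℝ} {x y z : X}
    (hxy : EpsChain f ε x y) (hyz : EpsChain f ε y z) : EpsChain f ε x z :=
  epsChain_iff_transGen.2 ((epsChain_iff_transGen.1 hxy).trans (epsChain_iff_transGen.1 hyz))

theorem EpsChain.of_dist_lt {X : Type*} [MetricSpace X] {f : X → X} {ε : ℝ} {x y : X}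
    (h : dist (f x) y < ε) : EpsChain f ε x y :=
  epsChain_iff_transGen.2 (.single h)

/-- An ε-chain ending on a bitrajectory can be continued along it. -/
theorem EpsChain.traj_add {X : Type*} [MetricSpace X] {f : X → X} {t : ℤ → X}
    (ht : ∀ n : ℤ, f (t n) = t (n + 1)) {ε : ℝ} (hε : 0 < ε) {x : X} {j : ℤ}
    (h : EpsChain f ε x (t j)) (k : ℕ) : EpsChain f ε x (t (j + k)) := by
  induction k with
  | zero => simpa using h
  | succ k ih =>
    refine ih.trans (.of_dist_lt ?_)
    rw [ht]
    simpa [add_assoc] using hε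

/-- Every backward limit point of a bitrajectory is joined to every forward limit point
by ε-chains. -/
theorem epsChain_of_mem_alphaTraj_of_mem_omegaTraj {X : Type*} [MetricSpace X] {f : X → X}
    (hf : Continuous f) {t : ℤ → X} (ht : ∀ n : ℤ, f (t n) = t (n + 1)) {a b : X}
    (ha : a ∈ alphaTraj t) (hb : b ∈ omegaTraj t) {ε : ℝ} (hε : 0 < ε) :
    EpsChain f ε a b := by
  obtain ⟨n, -, hn, hna⟩ := ha
  obtain ⟨m, -, hm, hmb⟩ := hb
  obtain ⟨k, hk⟩ :=
    (((hf.tendsto a).comp hna).eventually (Metric.ball_mem_nhds (f a) hε)).exists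
  obtain ⟨l, hl⟩ := (hmb.eventually (Metric.ball_mem_nhds b hε)).exists
  have hstart : EpsChain f ε a (t (-(n k : ℤ) + 1)) := by
    refine .of_dist_lt ?_
    rw [← ht, dist_comm]
    exact hk
  have hnk := hn k
  have hml := hm l
  have hmid := hstart.traj_add ht hε (n k + m l - 2)
  rw [show -(n k : ℤ) + 1 + ((n k + m l - 2 : ℕ) : ℤ) = (m l : ℤ) - 1 by omega] at hmid
  refine hmid.trans (.of_dist_lt ?_)
  rw [ht, sub_add_cancel]
  exact hl

theorem alphaTraj_nonempty {X : Type*} [MetricSpace X] [CompactSpace X] (t : ℤ → X) :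
    (alphaTraj t).Nonempty := by
  obtain ⟨a, φ, hφ, h⟩ := CompactSpace.tendsto_subseq fun n : ℕ => t (-((n + 1 : ℕ) : ℤ))
  exact ⟨a, fun k => φ k + 1, fun _ _ hij => Nat.succ_lt_succ (hφ hij),
    fun _ => Nat.succ_pos _, h⟩

theorem omegaTraj_nonempty {X : Type*} [MetricSpace X] [CompactSpace X] (t : ℤ → X) :
    (omegaTraj t).Nonempty := by
  obtain ⟨a, φ, hφ, h⟩ := CompactSpace.tendsto_subseq fun n : ℕ => t ((n + 1 : ℕ) : ℤ)
  exact ⟨a, fun k => φ k + 1, fun _ _ hij => Nat.succ_lt_succ (hφ hij),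
    fun _ => Nat.succ_pos _, h⟩

theorem ChainEquiv.symm {X : Type*} [MetricSpace X] {f : X → X} {x y : X}
    (h : ChainEquiv f x y) : ChainEquiv f y x :=
  fun ε hε => (h ε hε).symm

theorem ChainEquiv.trans {X : Type*} [MetricSpace X] {f : X → X} {x y z : X}
    (hxy : ChainEquiv f x y) (hyz : ChainEquiv f y z) : ChainEquiv f x z :=
  fun ε hε => ⟨(hxy ε hε).1.trans (hyz ε hε).1, (hyz ε hε).2.trans (hxy ε hε).2⟩

/-- The graph of a dynamical system on a compact metric space has no loops: if there
is a bitrajectory from node `A` to node `B` and one from `B` to `A`, then `A = B`. -/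
theorem no_loops {X : Type*} [MetricSpace X] [CompactSpace X]
    (f : X → X) (hf : Continuous f) (A B : Set X)
    (hA : IsNode f A) (hB : IsNode f B)
    (t t' : ℤ → X)
    (ht : ∀ n : ℤ, f (t n) = t (n + 1)) (ht' : ∀ n : ℤ, f (t' n) = t' (n + 1))
    (htα : alphaTraj t ⊆ A) (htω : omegaTraj t ⊆ B)
    (ht'α : alphaTraj t' ⊆ B) (ht'ω : omegaTraj t' ⊆ A) :
    A = B := by
  obtain ⟨x, -, rfl⟩ := hA
  obtain ⟨y, -, rfl⟩ := hB
  obtain ⟨a, ha⟩ := alphaTraj_nonempty t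
  obtain ⟨b, hb⟩ := omegaTraj_nonempty t
  obtain ⟨b', hb'⟩ := alphaTraj_nonempty t'
  obtain ⟨a', ha'⟩ := omegaTraj_nonempty t'
  have hxy : ChainEquiv f x y := fun ε hε =>
    ⟨((htα ha).2 ε hε).1.trans
      ((epsChain_of_mem_alphaTraj_of_mem_omegaTraj hf ht ha hb hε).trans ((htω hb).2 ε hε).2),
    ((ht'α hb').2 ε hε).1.trans
      ((epsChain_of_mem_alphaTraj_of_mem_omegaTraj hf ht' hb' ha' hε).trans
        ((ht'ω ha').2 ε hε).2)⟩
  ext z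
  exact ⟨fun hz => ⟨hz.1, hxy.symm.trans hz.2⟩, fun hz => ⟨hz.1, hxy.trans hz.2⟩⟩
end

section
/- Let f : [a,b] → [a,b] be continuous with f(a) = a, and suppose there is c ∈ (a,b) such that f is strictly increasing on [a,c] and strictly decreasing on [c,b], that f(x) > x for every x ∈ (a,c], and that f has a fixed point p̄ ∈ (c,b). Then the interval [f²(c), f(c)] is forward invariant: f([f²(c), f(c)]) ⊆ [f²(c), f(c)]. -/
open Set

/-- If `f : [a,b] → [a,b]` is continuous with `f a = a`, unimodal with maximum at
`c ∈ (a,b)`, satisfies `f x > x` on `(a,c]`, and has a fixed point `p̄ ∈ (c,b)`,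
then the interval `[f²(c), f(c)]` is forward invariant. -/
theorem trapping_interval {a b c pbar : ℝ} (f : ℝ → ℝ)
    (hab : a < b)
    (hmaps : MapsTo f (Icc a b) (Icc a b))
    (hcont : ContinuousOn f (Icc a b))
    (hfa : f a = a)
    (hc : c ∈ Ioo a b)
    (hinc : StrictMonoOn f (Icc a c))
    (hdec : StrictAntiOn f (Icc c b))
    (hgt : ∀ x ∈ Ioc a c, x < f x)
    (hpbar : pbar ∈ Ioo c b)
    (hfix : f pbar = pbar) :
    MapsTo f (Icc (f (f c)) (f c)) (Icc (f (f c)) (f c)) := by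
  have hcab : c ∈ Icc a b := Ioo_subset_Icc_self hc
  have hfc : f c ∈ Icc a b := hmaps hcab
  have hffc : f (f c) ∈ Icc a b := hmaps hfc
  rintro x ⟨hx₁, hx₂⟩
  have hax : a ≤ x := hffc.1.trans hx₁
  have hxb : x ≤ b := hx₂.trans hfc.2
  rcases le_total x c with hxc | hcx
  · have hle : x ≤ f x := by
      rcases hax.eq_or_lt with rfl | hlt
      · exact hfa.ge
      · exact (hgt x ⟨hlt, hxc⟩).le
    exact ⟨hx₁.trans hle, hinc.monotoneOn ⟨hax, hxc⟩ ⟨hcab.1, le_rfl⟩ hxc⟩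
  · exact ⟨hdec.antitoneOn ⟨hcx, hxb⟩ ⟨hcx.trans hx₂, hfc.2⟩ hx₂,
      hdec.antitoneOn ⟨le_rfl, hcab.2⟩ ⟨hcx, hxb⟩ hcx⟩
end

section
/- Let A be a finite alphabet and S ⊆ A^ℕ a one-sided subshift of finite type which is irreducible. Then every point of S has a backward dense bitrajectory: for every x ∈ S there is a sequence (s_k)_{k≤0} of elements of S with s_0 = x, σ(s_{k−1}) = s_k for every k ≤ 0, and such that the set {s_k : k ≤ 0} is dense in S. -/
open Set Filter Topology

section Shift

variable {A : Type*} [Fintype A] [TopologicalSpace A] [DiscreteTopology A]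

/-- The one-sided shift map on `A^ℕ`. -/
def shiftMap (s : ℕ → A) : ℕ → A := fun n => s (n + 1)

/-- A one-sided shift space: a nonempty closed shift-invariant subset of `A^ℕ`. -/
def IsShiftSpace (S : Set (ℕ → A)) : Prop :=
  S.Nonempty ∧ IsClosed S ∧ ∀ s ∈ S, shiftMap s ∈ S

/-- The word `w` occurs as a consecutive block in the sequence `s`. -/
def Occurs (w : List A) (s : ℕ → A) : Prop :=
  ∃ i : ℕ, ∀ j : ℕ, (hj : j < w.length) → s (i + j) = w.get ⟨j, hj⟩

/-- A word is admissible for `S` if it occurs in some element of `S`. -/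
def Admissible (S : Set (ℕ → A)) (w : List A) : Prop :=
  ∃ s ∈ S, Occurs w s

/-- `S` is irreducible if any two admissible words can be joined by a word so that
the concatenation is admissible. -/
def IrreducibleShift (S : Set (ℕ → A)) : Prop :=
  ∀ u v : List A, Admissible S u → Admissible S v →
    ∃ w : List A, Admissible S (u ++ w ++ v)

/-- `S` is a subshift of finite type: the set of sequences avoiding a finite set of
forbidden words. -/
def IsSFT (S : Set (ℕ → A)) : Prop :=
  ∃ F : Finset (List A), S = {s | ∀ w ∈ F, ¬ Occurs w s}

end Shift

theorem iterate_shiftMap_apply {A : Type*} (k : ℕ) (s : ℕ → A) (n : ℕ) :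
    shiftMap^[k] s n = s (n + k) := by
  induction k generalizing s with
  | zero => rfl
  | succ k ih => rw [Function.iterate_succ_apply, ih]; simp only [shiftMap, add_assoc]

theorem iterate_shiftMap_mem {A : Type*} {S : Set (ℕ → A)}
    (hS : ∀ s ∈ S, shiftMap s ∈ S) (k : ℕ) {s : ℕ → A} (hs : s ∈ S) : shiftMap^[k] s ∈ S :=
  (show MapsTo shiftMap S S from fun s hs => hS s hs).iterate k hs

theorem occurs_ofFn {A : Type*} (s : ℕ → A) (n : ℕ) :
    Occurs (List.ofFn fun i : Fin n => s i) s :=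
  ⟨0, fun j _ => by simp⟩

/-- In an irreducible subshift of finite type, every point has an iterated preimage that starts
with any given admissible word. -/
theorem IsSFT.exists_prepend {A : Type*} {S : Set (ℕ → A)} (hSFT : IsSFT S)
    (hirr : IrreducibleShift S) {y : ℕ → A} (hy : y ∈ S) {u : List A} (hu : Admissible S u) :
    ∃ z ∈ S, ∃ L, u.length ≤ L ∧ shiftMap^[L] z = y ∧
      ∀ j (hj : j < u.length), z j = u.get ⟨j, hj⟩ := by
  obtain ⟨F, rfl⟩ := hSFT
  set N := F.sup List.length
  obtain ⟨w, s, hs, i, hi⟩ := hirr u (List.ofFn fun i : Fin N => y i) hu ⟨y, hy, occurs_ofFn y N⟩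
  set L := u.length + w.length with hL
  have hsy : ∀ n, n < N → s (i + (L + n)) = y n := by
    intro n hn
    rw [hi (L + n) (by simp; omega)]
    simp only [List.get_eq_getElem]
    rw [List.getElem_append_right (by simp; omega)]
    simp [hL]
  have hsu : ∀ j (hj : j < u.length), s (i + j) = u.get ⟨j, hj⟩ := by
    intro j hj
    rw [hi j (by simp; omega)]
    simp [hj]
  refine ⟨fun n => if n < L then s (i + n) else y (n - L), ?_, L, by omega, ?_, ?_⟩
  · rintro f hf ⟨k, hk⟩
    have hfN : f.length ≤ N := Finset.le_sup (f := List.length) hf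
    by_cases hkL : k < L
    · refine hs f hf ⟨i + k, fun j hj => ?_⟩
      rw [← hk j hj]
      dsimp only
      split_ifs with h
      · rw [add_assoc]
      · rw [← hsy (k + j - L) (by omega)]
        congr 1
        omega
    · refine hy f hf ⟨k - L, fun j hj => ?_⟩
      rw [← hk j hj]
      dsimp only
      rw [if_neg (by omega)]
      congr 1
      omega
  · funext n
    rw [iterate_shiftMap_apply, if_neg (by omega), Nat.add_sub_cancel]
  · intro j hj
    rw [← hsu j hj]
    exact if_pos (by omega)

theorem IsSFT.exists_prepend_pos {A : Type*} {S : Set (ℕ → A)} (hSFT : IsSFT S)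
    (hirr : IrreducibleShift S) (u : List A) {y : ℕ → A} (hy : y ∈ S) :
    ∃ z ∈ S, ∃ L, 1 ≤ L ∧ shiftMap^[L] z = y ∧
      (Admissible S u → ∀ j (hj : j < u.length), z j = u.get ⟨j, hj⟩) := by
  by_cases hu : Admissible S u ∧ u ≠ []
  · obtain ⟨z, hz, L, hL, hzy, hzu⟩ := hSFT.exists_prepend hirr hy hu.1
    exact ⟨z, hz, L, (List.length_pos_iff.2 hu.2).trans_le hL, hzy, fun _ => hzu⟩
  · obtain ⟨z, hz, L, hL, hzy, -⟩ := hSFT.exists_prepend hirr hy ⟨y, hy, occurs_ofFn y 1⟩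
    refine ⟨z, hz, L, by simpa using hL, hzy, fun hadm j hj => ?_⟩
    rw [not_and_not_right.1 hu hadm] at hj
    exact absurd hj (Nat.not_lt_zero j)

/-- Successive preimages `z m` of `x`, at depths `a m`, interpolate to a full backward orbit. -/
theorem exists_backward_orbit_of_chain {A : Type*} {S : Set (ℕ → A)}
    (hS : ∀ s ∈ S, shiftMap s ∈ S) {z : ℕ → ℕ → A} {a : ℕ → ℕ} (hz : ∀ m, z m ∈ S)
    (hlt : ∀ m, a m < a (m + 1))
    (hstep : ∀ m, shiftMap^[a (m + 1) - a m] (z (m + 1)) = z m) :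
    ∃ s : ℕ → ℕ → A, (∀ k, s k ∈ S) ∧ (∀ k, shiftMap (s (k + 1)) = s k) ∧
      ∀ m, s (a m) = z m := by
  have hmono : StrictMono a := strictMono_nat_of_lt_succ hlt
  have hchain : ∀ m d, shiftMap^[a (m + d) - a m] (z (m + d)) = z m := by
    intro m d
    induction d with
    | zero => simp
    | succ d ih =>
      have h₁ := hmono.monotone (Nat.le_add_right m d)
      have h₂ := hlt (m + d)
      rw [← add_assoc, show a (m + d + 1) - a m
        = (a (m + d) - a m) + (a (m + d + 1) - a (m + d)) by omega,
        Function.iterate_add_apply, hstep, ih]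
  refine ⟨fun k => shiftMap^[a k - k] (z k), fun k => iterate_shiftMap_mem hS _ (hz k),
    fun k => ?_, fun m => ?_⟩
  · have h₁ := hmono.le_apply (x := k)
    have h₂ := hlt k
    dsimp only
    rw [← Function.iterate_succ_apply' shiftMap, show (a (k + 1) - (k + 1)).succ
      = (a k - k) + (a (k + 1) - a k) by omega, Function.iterate_add_apply, hstep]
  · have h := hchain m (a m - m)
    rwa [Nat.add_sub_cancel' hmono.le_apply] at h

/-- In an irreducible one-sided subshift of finite type, every point has a backward
dense bitrajectory: for every `x ∈ S` there is a backward orbit `(s k)` (indexed so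
that `s k` stands for the point at time `-k`) with `s 0 = x`, `σ (s (k+1)) = s k`,
whose terms form a dense subset of `S`. -/
theorem sft_backward_dense_bitrajectory
    {A : Type*} [Fintype A] [TopologicalSpace A] [DiscreteTopology A]
    (S : Set (ℕ → A)) (hS : IsShiftSpace S) (hSFT : IsSFT S)
    (hirr : IrreducibleShift S) :
    ∀ x ∈ S, ∃ s : ℕ → (ℕ → A),
      s 0 = x ∧ (∀ k, s k ∈ S) ∧ (∀ k, shiftMap (s (k + 1)) = s k) ∧
      S ⊆ closure (Set.range s) := by
  intro x hx
  obtain ⟨e, he⟩ := exists_surjective_nat (List A)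
  choose! pre hpre_mem L hL hshift hprefix using
    fun (u : List A) (y : ℕ → A) (hy : y ∈ S) => hSFT.exists_prepend_pos hirr u hy
  let z : ℕ → ℕ → A := fun m => Nat.rec x (fun m y => pre (e m) y) m
  let a : ℕ → ℕ := fun m => ∑ i ∈ Finset.range m, L (e i) (z i)
  have hz : ∀ m, z m ∈ S := by
    intro m
    induction m with
    | zero => exact hx
    | succ m ih => exact hpre_mem (e m) (z m) ih
  have ha : ∀ m, a (m + 1) = a m + L (e m) (z m) := fun m => Finset.sum_range_succ _ m
  obtain ⟨s, hsS, hs, hsz⟩ := exists_backward_orbit_of_chain hS.2.2 hz (a := a)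
    (fun m => by have := hL (e m) (z m) (hz m); have := ha m; omega)
    (fun m => by rw [ha, Nat.add_sub_cancel_left]; exact hshift (e m) (z m) (hz m))
  refine ⟨s, hsz 0, hsS, hs, fun t ht => ?_⟩
  rw [(PiNat.isTopologicalBasis_cylinders fun _ : ℕ => A).mem_closure_iff]
  rintro _ ⟨y, n, rfl⟩ hty
  obtain ⟨m, hm⟩ := he (List.ofFn fun i : Fin n => t i)
  refine ⟨s (a (m + 1)), fun i hi => ?_, mem_range_self _⟩
  have hpre := hprefix (e m) (z m) (hz m) (hm ▸ ⟨t, ht, occurs_ofFn t n⟩) i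
    (by simpa [hm] using hi)
  rw [hsz, ← hty i hi]
  refine Eq.trans hpre ?_
  simp [hm]
end

section
/- Let f : [a,b] → [a,b] be S-unimodal with f(a) = a and critical point c. Let p̄ ∈ (c,b) be a fixed point of f with p̄ < f(c), let p̂ ∈ [a,c) be the point with f(p̂) = p̄, and set J₁ = [p̂, p̄] and A = [f²(c), f(c)]. Assume that for every nondegenerate interval W ⊆ [a,b] containing c (in its interior or as an endpoint) there exists s ≥ 1 with J₁ ⊆ f^s(W). Then for every y ∈ [a,b] and every integer r ≥ 0 with f^r(y) = c, for every neighborhood V of y in [a,b], and for every interval I ⊆ A with p̄ ∉ I, there exists k ≥ 1 such that I ⊆ f^k(V). -/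
open Set Filter Topology

/-- An S-unimodal map on `[a,b]`: a `C³` self-map of `[a,b]` with `f a = f b`,
`a` or `b` fixed, a unique critical point `c ∈ (a,b)` which is a maximum, nonzero
derivative away from `c`, and negative Schwarzian derivative away from `c`. -/
structure SUnimodal (f : ℝ → ℝ) (a b c : ℝ) : Prop where
  lt_ab : a < b
  mapsTo : MapsTo f (Icc a b) (Icc a b)
  smooth : ContDiffOn ℝ 3 f (Icc a b)
  endpoints_eq : f a = f b
  fixed_endpoint : f a = a ∨ f b = b
  c_mem : c ∈ Ioo a b
  mono : StrictMonoOn f (Icc a c)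
  anti : StrictAntiOn f (Icc c b)
  deriv_ne : ∀ x ∈ Icc a b, x ≠ c → deriv f x ≠ 0
  schwarzian_neg : ∀ x ∈ Icc a b, x ≠ c →
    deriv^[3] f x / deriv f x - (3 / 2) * (deriv^[2] f x / deriv f x) ^ 2 < 0

/-- An S-unimodal map takes two different values on every nondegenerate subinterval. -/
theorem SUnimodal.exists_ne {f : ℝ → ℝ} {a b c : ℝ} (hf : SUnimodal f a b c)
    {u v : ℝ} (hau : a ≤ u) (hvb : v ≤ b) (huv : u < v) (y : ℝ) :
    ∃ z ∈ Icc u v, f z ≠ f y := by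
  have key : ∃ z ∈ Icc u v, ∃ w ∈ Icc u v, f z ≠ f w := by
    rcases lt_or_ge u c with huc | hcu
    · refine ⟨u, ⟨le_rfl, huv.le⟩, min v c,
        ⟨(lt_min huv huc).le, min_le_left _ _⟩, (hf.mono ⟨hau, huc.le⟩
          ⟨hau.trans (lt_min huv huc).le, min_le_right _ _⟩ (lt_min huv huc)).ne⟩
    · exact ⟨u, ⟨le_rfl, huv.le⟩, v, ⟨huv.le, le_rfl⟩,
        (hf.anti ⟨hcu, huv.le.trans hvb⟩ ⟨hcu.trans huv.le, hvb⟩ huv).ne'⟩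
  obtain ⟨z, hz, w, hw, hne⟩ := key
  by_cases h : f z = f y
  · exact ⟨w, hw, fun hwy => hne (h.trans hwy.symm)⟩
  · exact ⟨z, hz, h⟩

/-- Iterates of a nondegenerate interval around `y` contain nondegenerate intervals around the
iterates of `y`. -/
theorem SUnimodal.exists_Icc_subset_iterate_image {f : ℝ → ℝ} {a b c : ℝ}
    (hf : SUnimodal f a b c) {u v y : ℝ} (hau : a ≤ u) (hvb : v ≤ b) (huv : u < v)
    (hy : y ∈ Icc u v) (r : ℕ) :
    ∃ u' v' : ℝ, a ≤ u' ∧ v' ≤ b ∧ u' < v' ∧ f^[r] y ∈ Icc u' v' ∧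
      Icc u' v' ⊆ f^[r] '' Icc u v := by
  induction r with
  | zero => exact ⟨u, v, hau, hvb, huv, hy, by simp⟩
  | succ r ih =>
    obtain ⟨u', v', hau', hvb', huv', hy', hsub⟩ := ih
    obtain ⟨z, hz, hne⟩ := hf.exists_ne hau' hvb' huv' (f^[r] y)
    have hcover : uIcc (f z) (f (f^[r] y)) ⊆ f '' Icc u' v' := by
      have hseg : uIcc z (f^[r] y) ⊆ Icc u' v' := uIcc_subset_Icc hz hy'
      exact (intermediate_value_uIcc (hf.smooth.continuousOn.mono
        (hseg.trans (Icc_subset_Icc hau' hvb')))).trans (image_mono hseg)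
    have hfz := hf.mapsTo (Icc_subset_Icc hau' hvb' hz)
    have hfy := hf.mapsTo (Icc_subset_Icc hau' hvb' hy')
    refine ⟨min (f z) (f (f^[r] y)), max (f z) (f (f^[r] y)), le_min hfz.1 hfy.1,
      max_le hfz.2 hfy.2, min_lt_max.2 hne, ?_, ?_⟩
    · rw [Function.iterate_succ_apply']
      exact ⟨min_le_right _ _, le_max_right _ _⟩
    · rw [Function.iterate_succ', image_comp]
      exact hcover.trans (image_mono hsub)

/-- A neighborhood within `[a,b]` of a point of `[a,b]` contains a nondegenerate interval around
that point. -/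
theorem exists_Icc_subset_of_mem_nhdsWithin_Icc {a b y : ℝ} (hab : a < b) (hy : y ∈ Icc a b)
    {V : Set ℝ} (hV : V ∈ 𝓝[Icc a b] y) :
    ∃ u v : ℝ, a ≤ u ∧ v ≤ b ∧ u < v ∧ y ∈ Icc u v ∧ Icc u v ⊆ V := by
  obtain ⟨ε, hε, hball⟩ := Metric.mem_nhdsWithin_iff.1 hV
  obtain ⟨hay, hyb⟩ := hy
  refine ⟨max a (y - ε / 2), min b (y + ε / 2), le_max_left _ _, min_le_left _ _, ?_,
    ⟨max_le hay (by linarith), le_min hyb (by linarith)⟩, fun x hx => hball ⟨?_, ?_⟩⟩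
  · exact max_lt (lt_min hab (by linarith)) (lt_min (by linarith) (by linarith))
  · have h1 := (le_max_right _ _).trans hx.1
    have h2 := hx.2.trans (min_le_right _ _)
    rw [Metric.mem_ball, Real.dist_eq, abs_lt]
    constructor <;> linarith
  · exact ⟨(le_max_left _ _).trans hx.1, hx.2.trans (min_le_left _ _)⟩

/-- If `p̄ ∈ (c,b)` is a fixed point with `p̄ < f c`, `p̂ ∈ [a,c)` the other
preimage of `p̄`, `J₁ = [p̂,p̄]`, `A = [f² c, f c]`, and every nondegenerate
subinterval of `[a,b]` containing `c` eventually covers `J₁` under iteration, then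
for every preimage `y` of `c`, every neighborhood `V` of `y` in `[a,b]` and every
interval `I ⊆ A` avoiding `p̄`, some iterate of `V` covers `I`. -/
theorem iterate_nbhd_covers_interval
    {a b c pbar phat : ℝ} {f : ℝ → ℝ}
    (hf : SUnimodal f a b c) (hfa : f a = a)
    (hpbar : pbar ∈ Ioo c b) (hfix : f pbar = pbar) (hpbar_lt : pbar < f c)
    (hphat : phat ∈ Ico a c) (hfphat : f phat = pbar)
    (hcover : ∀ u v : ℝ, a ≤ u → v ≤ b → u < v → c ∈ Icc u v →
      ∃ s : ℕ, 1 ≤ s ∧ Icc phat pbar ⊆ f^[s] '' Icc u v) :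
    ∀ y ∈ Icc a b, ∀ r : ℕ, f^[r] y = c →
      ∀ V : Set ℝ, V ⊆ Icc a b → V ∈ 𝓝[Icc a b] y →
        ∀ I : Set ℝ, I ⊆ Icc (f (f c)) (f c) → I.OrdConnected → pbar ∉ I →
          ∃ k : ℕ, 1 ≤ k ∧ I ⊆ f^[k] '' V := by
  intro y hy r hr V _ hV I hIA hI hpI
  have hcont := hf.smooth.continuousOn
  obtain ⟨hac, hcb⟩ := hf.c_mem
  obtain ⟨hcp, hpb⟩ := hpbar
  obtain ⟨u, v, hau, hvb, huv, hyuv, huvV⟩ :=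
    exists_Icc_subset_of_mem_nhdsWithin_Icc hf.lt_ab hy hV
  obtain ⟨u', v', hau', hvb', huv', hc', hsub⟩ :=
    hf.exists_Icc_subset_iterate_image hau hvb huv hyuv r
  rw [hr] at hc'
  obtain ⟨s, -, hs⟩ := hcover u' v' hau' hvb' huv' hc'
  have hJ : Icc phat pbar ⊆ f^[s + r] '' V := by
    rw [Function.iterate_add, image_comp]
    exact hs.trans (image_mono (hsub.trans (image_mono huvV)))
  have hright : Icc pbar (f c) ⊆ f^[s + r + 1] '' V := by
    rw [Function.iterate_succ', image_comp]
    have h := intermediate_value_Icc' hcp.le (hcont.mono (Icc_subset_Icc hac.le hpb.le))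
    rw [hfix] at h
    exact h.trans (image_mono ((Icc_subset_Icc_left hphat.2.le).trans hJ))
  have hleft : Icc (f (f c)) pbar ⊆ f^[s + r + 1 + 1] '' V := by
    rw [Function.iterate_succ', image_comp]
    have h := intermediate_value_Icc' hpbar_lt.le (hcont.mono
      (Icc_subset_Icc (hac.trans hcp).le (hf.mapsTo ⟨hac.le, hcb.le⟩).2))
    rw [hfix] at h
    exact h.trans (image_mono hright)
  by_cases hside : ∃ x ∈ I, x < pbar
  · obtain ⟨x, hxI, hxp⟩ := hside
    refine ⟨s + r + 1 + 1, by omega, fun z hz => hleft ⟨(hIA hz).1, ?_⟩⟩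
    by_contra! hlt
    exact hpI (hI.out hxI hz ⟨hxp.le, hlt.le⟩)
  · push Not at hside
    exact ⟨s + r + 1, by omega, fun z hz => hright ⟨hside z hz, (hIA hz).2⟩⟩
end

section
/- Let (A,d) be a metric space and f : A → A continuous. Suppose there exist a point c ∈ A and a bitrajectory τ of f based at c whose backward orbit {τ(−n) : n ≥ 1} is dense in A. Suppose moreover that for every x ∈ A, every integer n ≥ 1 and every ε > 0 there exist an integer m ≥ 1 and a point z ∈ A with f^m(z) = x and d(z, τ(−n)) < ε. Then every point x ∈ A admits a bitrajectory t of f based at x whose backward orbit {t(−n) : n ≥ 1} is dense in A. -/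
open Set Filter Topology

/-- A backward orbit of `f` extends to a bitrajectory of `f`. -/
theorem exists_bitrajectory_of_backward_orbit {A : Type*} {f : A → A} {s : ℕ → A}
    (hs : ∀ n, f (s (n + 1)) = s n) :
    ∃ t : ℤ → A, (∀ n : ℕ, t (-(n : ℤ)) = s n) ∧ ∀ n : ℤ, f (t n) = t (n + 1) := by
  refine ⟨fun n => f^[n.toNat] (s (-n).toNat), fun n => by simp, fun n => ?_⟩
  rcases le_or_gt 0 n with hn | hn
  · have h₁ : (n + 1).toNat = n.toNat + 1 := by omega
    have h₂ : (-(n + 1)).toNat = (-n).toNat := by omega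
    simp only [h₁, h₂, Function.iterate_succ_apply']
  · have h₁ : (n + 1).toNat = 0 := by omega
    have h₂ : n.toNat = 0 := by omega
    have h₃ : (-n).toNat = (-(n + 1)).toNat + 1 := by omega
    simp only [h₁, h₂, h₃, Function.iterate_zero, id_eq, hs]

/-- A sequence in which each term is an iterate of the next one, of positive order, can be filled in
to a backward orbit, with the terms after the initial one occurring at positive times. -/
theorem exists_backward_orbit_through {A : Type*} {f : A → A} {z : ℕ → A} {m : ℕ → ℕ}
    (hm : ∀ k, 1 ≤ m k) (hz : ∀ k, f^[m k] (z (k + 1)) = z k) :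
    ∃ s : ℕ → A, s 0 = z 0 ∧ (∀ n, f (s (n + 1)) = s n) ∧
      ∀ k, ∃ n, 1 ≤ n ∧ s n = z (k + 1) := by
  set M : ℕ → ℕ := fun k => ∑ i ∈ Finset.range k, m i with hM
  have M_succ (k : ℕ) : M (k + 1) = M k + m k := Finset.sum_range_succ m k
  have le_M (k : ℕ) : k ≤ M k := by
    induction k with
    | zero => exact Nat.zero_le _
    | succ k ih => have := hm k; have := M_succ k; omega
  have iterate_eq {n j k : ℕ} (hn : n ≤ M j) (hjk : j ≤ k) :
      n ≤ M k ∧ f^[M k - n] (z k) = f^[M j - n] (z j) := by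
    induction k, hjk using Nat.le_induction with
    | base => exact ⟨hn, rfl⟩
    | succ k _ ih =>
      have h := M_succ k
      have hk : M (k + 1) - n = (M k - n) + m k := by omega
      refine ⟨by omega, ?_⟩
      rw [hk, Function.iterate_add_apply, hz, ih.2]
  refine ⟨fun n => f^[M n - n] (z n), by simp [hM], fun n => ?_, fun k => ?_⟩
  · have hn : M (n + 1) - n = M (n + 1) - (n + 1) + 1 := by have := le_M (n + 1); omega
    beta_reduce
    rw [← (iterate_eq (le_M n) n.le_succ).2, hn, Function.iterate_succ_apply']
  · refine ⟨M (k + 1), (Nat.le_add_left 1 k).trans (le_M _), ?_⟩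
    simpa using (iterate_eq le_rfl (le_M (k + 1))).2

/-- If `f : A → A` is continuous on a metric space, some point `c` has a
bitrajectory `τ` whose backward orbit is dense, and every point of `A` has
preimages of arbitrarily high order arbitrarily close to each backward iterate
`τ(−n)`, then every point of `A` admits a bitrajectory whose backward orbit is
dense. -/
theorem backward_dense_bitrajectory_everywhere
    {A : Type*} [MetricSpace A] (f : A → A) (hf : Continuous f)
    (c : A) (τ : ℤ → A) (hτ0 : τ 0 = c) (hτ : ∀ n : ℤ, f (τ n) = τ (n + 1))
    (hdense : Dense {y | ∃ n : ℕ, 1 ≤ n ∧ τ (-(n : ℤ)) = y})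
    (happrox : ∀ x : A, ∀ n : ℕ, 1 ≤ n → ∀ ε > (0 : ℝ),
      ∃ m : ℕ, 1 ≤ m ∧ ∃ z : A, f^[m] z = x ∧ dist z (τ (-(n : ℤ))) < ε) :
    ∀ x : A, ∃ t : ℤ → A, t 0 = x ∧ (∀ n : ℤ, f (t n) = t (n + 1)) ∧
      Dense {y | ∃ n : ℕ, 1 ≤ n ∧ t (-(n : ℤ)) = y} := by
  intro x
  choose m hm z hz hd using happrox
  -- the target `τ (-(i + 1))` is approached at infinitely many steps `k`, with tolerance `1 / (k + 1)`
  let w : ℕ → A := fun k =>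
    Nat.rec x (fun k y => z y (k.unpair.1 + 1) (Nat.le_add_left 1 _) (1 / (k + 1))
      Nat.one_div_pos_of_nat) k
  obtain ⟨s, hs0, hs, hsw⟩ := exists_backward_orbit_through (f := f) (z := w)
    (fun k => hm (w k) (k.unpair.1 + 1) (Nat.le_add_left 1 _) (1 / (k + 1))
      Nat.one_div_pos_of_nat)
    (fun k => hz _ _ _ _ _)
  obtain ⟨t, hts, ht⟩ := exists_bitrajectory_of_backward_orbit hs
  refine ⟨t, (hts 0).trans hs0, ht, dense_closure.1 (hdense.mono ?_)⟩
  rintro _ ⟨n, hn, rfl⟩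
  refine Metric.mem_closure_iff.2 fun ε hε => ?_
  obtain ⟨N, hN⟩ := exists_nat_one_div_lt hε
  obtain ⟨l, hl, hlw⟩ := hsw (Nat.pair (n - 1) N)
  refine ⟨w (Nat.pair (n - 1) N + 1), ⟨l, hl, (hts l).trans hlw⟩, ?_⟩
  have hdist : dist (w (Nat.pair (n - 1) N + 1))
      (τ (-(((Nat.pair (n - 1) N).unpair.1 + 1 : ℕ) : ℤ))) <
      1 / ((Nat.pair (n - 1) N : ℕ) + 1 : ℝ) := hd _ _ _ _ _
  rw [Nat.unpair_pair, Nat.sub_add_cancel hn] at hdist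
  rw [dist_comm]
  exact (hdist.trans_le (Nat.one_div_le_one_div (Nat.right_le_pair _ _))).trans hN
end

section
/- Let f : [a,b] → [a,b] be S-unimodal with f(a) = a, critical point c, and f(x) > x for all x ∈ (a,c]. Then every x ∈ [a, f(c)] admits a bitrajectory t of f based at x with t(−n) → a as n → ∞; consequently a ∈ sα_f(x) for every x ∈ [a, f(c)]. -/
open Set Filter Topology

/-- A bitrajectory of `f` based at `x` with values in the domain `D`. -/
def IsBitrajOn (f : ℝ → ℝ) (D : Set ℝ) (x : ℝ) (t : ℤ → ℝ) : Prop :=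
  t 0 = x ∧ (∀ n : ℤ, t n ∈ D) ∧ ∀ n : ℤ, f (t n) = t (n + 1)

/-- The special α-limit set of `x` under `f` regarded as a map of the domain `D`. -/
def sAlphaOn (f : ℝ → ℝ) (D : Set ℝ) (x : ℝ) : Set ℝ :=
  {y | ∃ (Y : ℕ → ℝ) (k : ℕ → ℕ), Y 0 = x ∧ (∀ n, Y n ∈ D) ∧
    (∀ n, 1 ≤ n → 1 ≤ k n ∧ f^[k n] (Y n) = Y (n - 1)) ∧
    Tendsto Y atTop (𝓝 y)}

/-- Every point of `[a, f c]` has a preimage in `[a, c]`, lying weakly to its left. -/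
theorem SUnimodal.exists_left_preimage {a b c : ℝ} {f : ℝ → ℝ} (hf : SUnimodal f a b c)
    (hfa : f a = a) (hgt : ∀ x ∈ Ioc a c, x < f x) {x : ℝ} (hx : x ∈ Icc a (f c)) :
    ∃ y ∈ Icc a c, f y = x ∧ y ≤ x := by
  have hcont : ContinuousOn f (Icc a c) :=
    hf.smooth.continuousOn.mono (Icc_subset_Icc_right hf.c_mem.2.le)
  obtain ⟨y, hy, rfl⟩ := intermediate_value_Icc hf.c_mem.1.le hcont (by rwa [hfa])
  refine ⟨y, hy, rfl, ?_⟩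
  rcases hy.1.eq_or_lt with rfl | h
  · exact hfa.ge
  · exact (hgt y ⟨h, hy.2⟩).le

/-- Every point of `[a, f c]` starts a backward orbit in `[a, f c]` converging to `a`. -/
theorem SUnimodal.exists_backward_orbit {a b c : ℝ} {f : ℝ → ℝ} (hf : SUnimodal f a b c)
    (hfa : f a = a) (hgt : ∀ x ∈ Ioc a c, x < f x) {x : ℝ} (hx : x ∈ Icc a (f c)) :
    ∃ Y : ℕ → ℝ, Y 0 = x ∧ (∀ n, Y n ∈ Icc a (f c)) ∧ (∀ n, f (Y (n + 1)) = Y n) ∧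
      Tendsto Y atTop (𝓝 a) := by
  have hc : c < f c := hgt c ⟨hf.c_mem.1, le_rfl⟩
  choose! g hg hfg hgle using fun y (hy : y ∈ Icc a (f c)) =>
    hf.exists_left_preimage hfa hgt hy
  have hmem : ∀ n, g^[n] x ∈ Icc a (f c) := by
    intro n
    induction n with
    | zero => exact hx
    | succ n ih =>
      rw [Function.iterate_succ_apply']
      exact Icc_subset_Icc_right hc.le (hg _ ih)
  have hmem' : ∀ n, g^[n + 1] x ∈ Icc a c := fun n => by
    rw [Function.iterate_succ_apply']
    exact hg _ (hmem n)
  have hstep : ∀ n, f (g^[n + 1] x) = g^[n] x := fun n => by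
    rw [Function.iterate_succ_apply']
    exact hfg _ (hmem n)
  have hanti : Antitone fun n => g^[n] x := antitone_nat_of_succ_le fun n => by
    rw [Function.iterate_succ_apply']
    exact hgle _ (hmem n)
  refine ⟨fun n => g^[n] x, rfl, hmem, hstep, ?_⟩
  have hlim := tendsto_atTop_ciInf hanti ⟨a, by rintro _ ⟨n, rfl⟩; exact (hmem n).1⟩
  set L := ⨅ n, g^[n] x
  have hlim' : Tendsto (fun n => g^[n + 1] x) atTop (𝓝 L) :=
    hlim.comp (tendsto_add_atTop_nat 1)
  have hL : L ∈ Icc a c := isClosed_Icc.mem_of_tendsto hlim' (Eventually.of_forall hmem')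
  have hcont : ContinuousWithinAt f (Icc a c) L :=
    hf.smooth.continuousOn.mono (Icc_subset_Icc_right hf.c_mem.2.le) L hL
  have hfL : Tendsto (fun n => f (g^[n + 1] x)) atTop (𝓝 (f L)) :=
    hcont.tendsto.comp (tendsto_nhdsWithin_iff.2 ⟨hlim', Eventually.of_forall hmem'⟩)
  simp only [hstep] at hfL
  have hfix : f L = L := tendsto_nhds_unique hfL hlim
  have hLa : L = a := by
    by_contra hne
    exact (hgt L ⟨lt_of_le_of_ne hL.1 (Ne.symm hne), hL.2⟩).ne' hfix
  rwa [hLa] at hlim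

/-- A backward orbit in an invariant domain extends to a bitrajectory. -/
theorem exists_isBitrajOn_of_backward_orbit {f : ℝ → ℝ} {D : Set ℝ} (hD : MapsTo f D D)
    {Y : ℕ → ℝ} (hY : ∀ n, Y n ∈ D) (hstep : ∀ n, f (Y (n + 1)) = Y n) :
    ∃ t : ℤ → ℝ, IsBitrajOn f D (Y 0) t ∧ ∀ n : ℕ, t (-(n : ℤ)) = Y n := by
  refine ⟨fun n => f^[n.toNat] (Y (-n).toNat), ⟨rfl, fun n => hD.iterate _ (hY _), ?_⟩, ?_⟩
  · intro n
    dsimp only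
    rcases le_or_gt 0 n with hn | hn
    · rw [← Function.iterate_succ_apply' f]
      congr 2 <;> omega
    · obtain ⟨m, rfl⟩ : ∃ m : ℕ, n = -((m : ℤ) + 1) := ⟨(-n - 1).toNat, by omega⟩
      have h₁ : (-((m : ℤ) + 1)).toNat = 0 := by omega
      have h₂ : (- -((m : ℤ) + 1)).toNat = m + 1 := by omega
      have h₃ : (-((m : ℤ) + 1) + 1).toNat = 0 := by omega
      have h₄ : (-(-((m : ℤ) + 1) + 1)).toNat = m := by omega
      rw [h₁, h₂, h₃, h₄]
      exact hstep m
  · intro n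
    simp

/-- For an S-unimodal map with `f a = a` and `f x > x` on `(a,c]`, every point of
`[a, f c]` admits a bitrajectory converging backward to `a`; consequently
`a ∈ sα_f(x)` for every such point. -/
theorem bitrajectory_to_left_endpoint
    {a b c : ℝ} {f : ℝ → ℝ} (hf : SUnimodal f a b c)
    (hfa : f a = a) (hgt : ∀ x ∈ Ioc a c, x < f x) :
    ∀ x ∈ Icc a (f c),
      (∃ t : ℤ → ℝ, IsBitrajOn f (Icc a b) x t ∧
        Tendsto (fun n : ℕ => t (-(n : ℤ))) atTop (𝓝 a)) ∧
      a ∈ sAlphaOn f (Icc a b) x := by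
  intro x hx
  obtain ⟨Y, rfl, hY, hstep, hlim⟩ := hf.exists_backward_orbit hfa hgt hx
  have hD : ∀ n, Y n ∈ Icc a b := fun n =>
    Icc_subset_Icc_right (hf.mapsTo (Ioo_subset_Icc_self hf.c_mem)).2 (hY n)
  refine ⟨?_, Y, fun _ => 1, rfl, hD, fun n hn => ⟨le_rfl, ?_⟩, hlim⟩
  · obtain ⟨t, ht, htY⟩ := exists_isBitrajOn_of_backward_orbit hf.mapsTo hD hstep
    exact ⟨t, ht, by simpa only [htY] using hlim⟩
  · obtain ⟨m, rfl⟩ := Nat.exists_eq_add_of_le' hn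
    exact hstep m
end

section
/- Let f : [a,b] → [a,b] be an S-unimodal map. Then for every x ∈ [a,b], the special α-limit set sα_f(x) is a closed subset of [a,b]. (This establishes, for S-unimodal maps, the conjecture of Kolyada, Misiurewicz and Snoha that all special α-limit sets of points of interval maps are closed.) -/
open Set Filter Topology

/-- `z` is a backward orbit of `x` under `f`. -/
def BackOrbit (f : ℝ → ℝ) (x : ℝ) (z : ℕ → ℝ) : Prop :=
  z 0 = x ∧ ∀ n, f (z (n + 1)) = z n

/-- The points reached in forward time from the one-sided neighbourhood `(y, y + ε)`. -/
def reach (f : ℝ → ℝ) (y ε : ℝ) : Set ℝ :=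
  {p | ∃ k : ℕ, ∃ u ∈ Ioo y (y + ε), f^[k] u = p}

/-- On `T` the map `f` is strictly monotone, in opposite directions, on the two sides of `c`. -/
def FoldOn (f : ℝ → ℝ) (T : Set ℝ) (c : ℝ) : Prop :=
  (StrictMonoOn f (T ∩ Iic c) ∧ StrictAntiOn f (T ∩ Ici c)) ∨
    (StrictAntiOn f (T ∩ Iic c) ∧ StrictMonoOn f (T ∩ Ici c))

/-- `E` is the component of `reach f y ε` containing `(y, y + ε)`, and the components of
`reach f y ε` are the pairwise disjoint images `f^[j] '' E` for `j < m`. -/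
structure ReachCycle (f : ℝ → ℝ) (y ε : ℝ) (E : Set ℝ) (m : ℕ) : Prop where
  period_pos : 0 < m
  ordConnected : E.OrdConnected
  Ioo_subset : Ioo y (y + ε) ⊆ E
  subset_reach : E ⊆ reach f y ε
  maximal : ∀ T : Set ℝ, T.OrdConnected → T ⊆ reach f y ε → (T ∩ E).Nonempty → T ⊆ E
  mapsTo : MapsTo f^[m] E E
  cover : ∀ p ∈ reach f y ε, ∃ j < m, p ∈ f^[j] '' E
  disjoint : ∀ i < m, ∀ j < m, ∀ p, p ∈ f^[i] '' E → p ∈ f^[j] '' E → i = j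

section Basic

variable {f : ℝ → ℝ} {x y c ε : ℝ} {z : ℕ → ℝ}

theorem BackOrbit.iterate_add (h : BackOrbit f x z) (k n : ℕ) : f^[k] (z (n + k)) = z n := by
  induction k with
  | zero => rfl
  | succ k ih => rw [Function.iterate_succ_apply, ← add_assoc, h.2, ih]

theorem BackOrbit.tail (h : BackOrbit f x z) : BackOrbit f (z 1) (fun n => z (n + 1)) :=
  ⟨rfl, fun n => h.2 (n + 1)⟩

theorem reach_mono {ε' : ℝ} (h : ε' ≤ ε) : reach f y ε' ⊆ reach f y ε := by
  rintro p ⟨k, u, hu, rfl⟩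
  exact ⟨k, u, ⟨hu.1, hu.2.trans_le (by linarith)⟩, rfl⟩

theorem iterate_mem_reach {p : ℝ} (h : p ∈ reach f y ε) (k : ℕ) : f^[k] p ∈ reach f y ε := by
  obtain ⟨l, u, hu, rfl⟩ := h
  exact ⟨k + l, u, hu, Function.iterate_add_apply f k l u⟩

theorem Ioo_subset_reach : Ioo y (y + ε) ⊆ reach f y ε := fun u hu => ⟨0, u, hu, rfl⟩

theorem BackOrbit.mem_reach (h : BackOrbit f x z) (hz : ∃ᶠ n in atTop, z n ∈ Ioo y (y + ε))
    (n : ℕ) : z n ∈ reach f y ε := by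
  obtain ⟨N, hN, hu⟩ := frequently_atTop.1 hz n
  refine ⟨N - n, z N, hu, ?_⟩
  have := h.iterate_add (N - n) n
  rwa [Nat.add_sub_cancel' hN] at this

/-- A chain of iterated preimages refines to a backward orbit. -/
theorem exists_backOrbit_of_chain {Y : ℕ → ℝ} (h0 : Y 0 = x)
    (h : ∀ n, ∃ k, 1 ≤ k ∧ f^[k] (Y (n + 1)) = Y n) (hY : Tendsto Y atTop (𝓝 y)) :
    ∃ z, BackOrbit f x z ∧ MapClusterPt y atTop z := by
  choose k hk1 hk using h
  let s : ℕ → ℕ := fun n => ∑ i ∈ Finset.range n, k i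
  have hs : ∀ n, s (n + 1) = s n + k n := fun n => Finset.sum_range_succ _ _
  have hs_mono : StrictMono s := strictMono_nat_of_lt_succ fun n => by
    rw [hs]; have := hk1 n; omega
  have hs_id : ∀ n, n ≤ s n := fun n => hs_mono.le_apply
  have key : ∀ d n, f^[s (n + d) - s n] (Y (n + d)) = Y n := by
    intro d n
    induction d with
    | zero => simp
    | succ d ih =>
      have h1 : s n ≤ s (n + d) := hs_mono.monotone (by omega)
      have h2 : s (n + (d + 1)) - s n = (s (n + d) - s n) + k (n + d) := by
        have := hs (n + d)
        rw [← add_assoc]; omega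
      rw [h2, Function.iterate_add_apply, ← add_assoc, hk, ih]
  refine ⟨fun j => f^[s j - j] (Y j), ⟨by simpa [s] using h0, fun j => ?_⟩, ?_⟩
  · have h2 : s (j + 1) - (j + 1) + 1 = (s j - j) + k j := by
      have := hs j; have := hs_id j; have := hk1 j; omega
    change f (f^[s (j + 1) - (j + 1)] (Y (j + 1))) = f^[s j - j] (Y j)
    rw [← Function.iterate_succ_apply' f, Nat.succ_eq_add_one, h2, Function.iterate_add_apply, hk]
  · have : Tendsto ((fun j => f^[s j - j] (Y j)) ∘ s) atTop (𝓝 y) := by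
      refine hY.congr fun n => ?_
      have := key (s n - n) n
      rw [Nat.add_sub_cancel' (hs_id n)] at this
      exact this.symm
    exact MapClusterPt.of_comp hs_mono.tendsto_atTop this.mapClusterPt

theorem exists_reachCycle (hf : Continuous f) (hε : 0 < ε)
    (hret : ∃ k, 0 < k ∧ ∃ u ∈ Ioo y (y + ε), f^[k] u ∈ Ioo y (y + ε)) :
    ∃ E m, ReachCycle f y ε E m := by
  classical
  set u₀ := y + ε / 2 with hu₀
  have hu₀U : u₀ ∈ Ioo y (y + ε) := ⟨by linarith, by linarith⟩
  set E := ordConnectedComponent (reach f y ε) u₀ with hE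
  have hEc : E.OrdConnected := inferInstance
  have hEW : E ⊆ reach f y ε := ordConnectedComponent_subset
  have hu₀E : u₀ ∈ E := self_mem_ordConnectedComponent.2 (Ioo_subset_reach hu₀U)
  have hmax : ∀ T : Set ℝ, T.OrdConnected → T ⊆ reach f y ε → (T ∩ E).Nonempty → T ⊆ E := by
    rintro T hT hTW ⟨p, hpT, hpE⟩ q hq
    have h1 : uIcc u₀ p ⊆ reach f y ε := (hEc.uIcc_subset hu₀E hpE).trans hEW
    have h2 : uIcc p q ⊆ reach f y ε := (hT.uIcc_subset hpT hq).trans hTW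
    exact uIcc_subset_uIcc_union_uIcc.trans (union_subset h1 h2)
  have hUE : Ioo y (y + ε) ⊆ E := hmax _ ordConnected_Ioo Ioo_subset_reach ⟨u₀, hu₀U, hu₀E⟩
  have himg : ∀ j, (f^[j] '' E).OrdConnected := fun j =>
    (hEc.isPreconnected.image _ (hf.iterate j).continuousOn).ordConnected
  have himgW : ∀ j, f^[j] '' E ⊆ reach f y ε := by
    rintro j _ ⟨p, hp, rfl⟩
    exact iterate_mem_reach (hEW hp) j
  have hret' : ∃ k, 0 < k ∧ (f^[k] '' E ∩ E).Nonempty := by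
    obtain ⟨k, hk, u, hu, hku⟩ := hret
    exact ⟨k, hk, f^[k] u, mem_image_of_mem _ (hUE hu), hUE hku⟩
  set m := Nat.find hret'
  obtain ⟨hm0, hm⟩ := Nat.find_spec hret'
  have hmin : ∀ k, 0 < k → k < m → ¬ (f^[k] '' E ∩ E).Nonempty := fun k hk hkm h =>
    Nat.find_min hret' hkm ⟨hk, h⟩
  have hmap : MapsTo f^[m] E E := mapsTo_iff_image_subset.2 (hmax _ (himg m) (himgW m) hm)
  have hlt : ∀ i j p, i < j → j < m → p ∈ f^[i] '' E → p ∈ f^[j] '' E → False := by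
    rintro i j p hij hjm ⟨q, hq, rfl⟩ ⟨r, hr, hrq⟩
    refine hmin (m - j + i) (by omega) (by omega)
      ⟨_, mem_image_of_mem _ hq, ?_⟩
    rw [Function.iterate_add_apply, ← hrq, ← Function.iterate_add_apply,
      Nat.sub_add_cancel hjm.le]
    exact hmap hr
  refine ⟨E, m, hm0, hEc, hUE, hEW, hmax, hmap, ?_, ?_⟩
  · rintro p ⟨k, u, hu, rfl⟩
    refine ⟨k % m, Nat.mod_lt _ hm0, f^[m * (k / m)] u, ?_, ?_⟩
    · rw [Function.iterate_mul]
      exact hmap.iterate _ (hUE hu)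
    · rw [← Function.iterate_add_apply, Nat.mod_add_div]
  · intro i hi j hj p hpi hpj
    rcases lt_trichotomy i j with h | h | h
    · exact (hlt i j p h hj hpi hpj).elim
    · exact h
    · exact (hlt j i p h hi hpj hpi).elim

theorem BackOrbit.exists_reachCycle (hf : Continuous f) (hε : 0 < ε) (h : BackOrbit f x z)
    (hz : ∃ᶠ n in atTop, z n ∈ Ioo y (y + ε)) : ∃ E m, ReachCycle f y ε E m := by
  obtain ⟨N, -, hN⟩ := frequently_atTop.1 hz 0
  obtain ⟨M, hM, hMu⟩ := frequently_atTop.1 hz (N + 1)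
  refine _root_.exists_reachCycle hf hε ⟨M - N, by omega, z M, hMu, ?_⟩
  have := h.iterate_add (M - N) N
  rw [Nat.add_sub_cancel' (by omega)] at this
  rwa [this]

namespace ReachCycle

variable {E : Set ℝ} {m : ℕ}

theorem mem_of_iterate_mem (hE : ReachCycle f y ε E m) {t : ℝ} (ht : t ∈ reach f y ε)
    (h : f^[m] t ∈ E) : t ∈ E := by
  obtain ⟨l, hl, q, hq, rfl⟩ := hE.cover t ht
  have h0 : 0 = l := by
    refine hE.disjoint 0 hE.period_pos l hl (f^[m] (f^[l] q)) ⟨_, h, rfl⟩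
      ⟨f^[m] q, hE.mapsTo hq, ?_⟩
    rw [← Function.iterate_add_apply, ← Function.iterate_add_apply, add_comm]
  subst h0
  exact hq

/-- A backward orbit in `reach f y ε` meets every image `f^[j] '' E` infinitely often. -/
theorem exists_mem_image (hE : ReachCycle f y ε E m) (h : BackOrbit f x z)
    (hz : ∀ n, z n ∈ reach f y ε) {j : ℕ} (hj : j < m) (N : ℕ) :
    ∃ n ≥ N, z n ∈ f^[j] '' E := by
  obtain ⟨l, hl, q, hq, hql⟩ := hE.cover _ (hz (N + m))
  rcases le_or_gt l j with hlj | hlj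
  · refine ⟨N + m - (j - l), by omega, q, hq, ?_⟩
    have := h.iterate_add (j - l) (N + m - (j - l))
    rw [← this, Nat.sub_add_cancel (by omega), ← hql, ← Function.iterate_add_apply,
      Nat.sub_add_cancel hlj]
  · refine ⟨N + (l - j), by omega, f^[m] q, hE.mapsTo hq, ?_⟩
    have := h.iterate_add (m - l + j) (N + (l - j))
    rw [← this, show N + (l - j) + (m - l + j) = N + m by omega, ← hql,
      ← Function.iterate_add_apply, ← Function.iterate_add_apply,
      show m - l + j + l = j + m by omega]

end ReachCycle

end Basic

section Fold

variable {f g : ℝ → ℝ} {c d : ℝ} {T : Set ℝ}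

theorem FoldOn.strictMonoOn_or_strictAntiOn (h : FoldOn f univ c) (hT : T.OrdConnected)
    (hc : c ∉ T) : StrictMonoOn f T ∨ StrictAntiOn f T := by
  have hside : T ⊆ Iic c ∨ T ⊆ Ici c := by
    by_contra! hcon
    obtain ⟨⟨p, hp, hpc⟩, q, hq, hqc⟩ :=
      And.intro (not_subset.1 hcon.1) (not_subset.1 hcon.2)
    exact hc (hT.out hq hp ⟨(not_le.1 hqc).le, (not_le.1 hpc).le⟩)
  have h' : ∀ s, T ⊆ s → T ⊆ univ ∩ s := fun s hs => subset_inter (subset_univ _) hs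
  rcases h with ⟨h1, h2⟩ | ⟨h1, h2⟩ <;> rcases hside with hs | hs
  · exact Or.inl (h1.mono (h' _ hs))
  · exact Or.inr (h2.mono (h' _ hs))
  · exact Or.inr (h1.mono (h' _ hs))
  · exact Or.inl (h2.mono (h' _ hs))

theorem FoldOn.strictMonoOn_or_strictAntiOn_iterate (hf : Continuous f) (h : FoldOn f univ c)
    (hT : T.OrdConnected) {j : ℕ} (hc : ∀ i < j, c ∉ f^[i] '' T) :
    StrictMonoOn f^[j] T ∨ StrictAntiOn f^[j] T := by
  induction j with
  | zero => exact Or.inl (strictMono_id.strictMonoOn T)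
  | succ j ih =>
    have hj : (f^[j] '' T).OrdConnected :=
      (hT.isPreconnected.image _ (hf.iterate j).continuousOn).ordConnected
    rw [Function.iterate_succ']
    have hm : MapsTo f^[j] T (f^[j] '' T) := mapsTo_image _ _
    rcases ih (fun i hi => hc i (by omega)) with h1 | h1 <;>
      rcases h.strictMonoOn_or_strictAntiOn hj (hc j (by omega)) with h2 | h2
    · exact Or.inl (h2.comp h1 hm)
    · exact Or.inr (h2.comp_strictMonoOn h1 hm)
    · exact Or.inr (h2.comp_strictAntiOn h1 hm)
    · exact Or.inl (h2.comp h1 hm)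

/-- Folds are stable under precomposition with a strictly monotone map. -/
theorem FoldOn.comp_right (h : FoldOn f univ c) (hd : d ∈ T) (hgd : g d = c)
    (hg : StrictMonoOn g T ∨ StrictAntiOn g T) : FoldOn (f ∘ g) T d := by
  subst hgd
  rcases hg with hg | hg
  · have m1 : MapsTo g (T ∩ Iic d) (univ ∩ Iic (g d)) := fun p hp =>
      ⟨trivial, hg.monotoneOn hp.1 hd hp.2⟩
    have m2 : MapsTo g (T ∩ Ici d) (univ ∩ Ici (g d)) := fun p hp =>
      ⟨trivial, hg.monotoneOn hd hp.1 hp.2⟩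
    have g1 := hg.mono (inter_subset_left (s := T) (t := Iic d))
    have g2 := hg.mono (inter_subset_left (s := T) (t := Ici d))
    rcases h with ⟨h1, h2⟩ | ⟨h1, h2⟩
    · exact Or.inl ⟨h1.comp g1 m1, h2.comp_strictMonoOn g2 m2⟩
    · exact Or.inr ⟨h1.comp_strictMonoOn g1 m1, h2.comp g2 m2⟩
  · have m1 : MapsTo g (T ∩ Iic d) (univ ∩ Ici (g d)) := fun p hp =>
      ⟨trivial, hg.antitoneOn hp.1 hd hp.2⟩
    have m2 : MapsTo g (T ∩ Ici d) (univ ∩ Iic (g d)) := fun p hp =>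
      ⟨trivial, hg.antitoneOn hd hp.1 hp.2⟩
    have g1 := hg.mono (inter_subset_left (s := T) (t := Iic d))
    have g2 := hg.mono (inter_subset_left (s := T) (t := Ici d))
    rcases h with ⟨h1, h2⟩ | ⟨h1, h2⟩
    · exact Or.inl ⟨h2.comp g1 m1, h1.comp_strictAntiOn g2 m2⟩
    · exact Or.inr ⟨h2.comp_strictAntiOn g1 m1, h1.comp g2 m2⟩

/-- Folds are stable under postcomposition with a strictly monotone map. -/
theorem FoldOn.comp_left (h : FoldOn f T c)
    (hg : StrictMonoOn g (f '' T) ∨ StrictAntiOn g (f '' T)) : FoldOn (g ∘ f) T c := by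
  have m1 : MapsTo f (T ∩ Iic c) (f '' T) := fun p hp => mem_image_of_mem f hp.1
  have m2 : MapsTo f (T ∩ Ici c) (f '' T) := fun p hp => mem_image_of_mem f hp.1
  rcases hg with hg | hg <;> rcases h with ⟨h1, h2⟩ | ⟨h1, h2⟩
  · exact Or.inl ⟨hg.comp h1 m1, hg.comp_strictAntiOn h2 m2⟩
  · exact Or.inr ⟨hg.comp_strictAntiOn h1 m1, hg.comp h2 m2⟩
  · exact Or.inr ⟨hg.comp_strictMonoOn h1 m1, hg.comp h2 m2⟩
  · exact Or.inl ⟨hg.comp h1 m1, hg.comp_strictMonoOn h2 m2⟩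

variable {y ε : ℝ} {E : Set ℝ} {m : ℕ}

/-- If `c` lies in the cycle of `E`, then the return map `f^[m]` to `E` is a fold. -/
theorem ReachCycle.foldOn (hE : ReachCycle f y ε E m) (hf : Continuous f) (h : FoldOn f univ c)
    {j : ℕ} (hj : j < m) (hd : d ∈ E) (hdc : f^[j] d = c) : FoldOn f^[m] E d := by
  have hcE : ∀ i < m, i ≠ j → c ∉ f^[i] '' E := fun i hi hij hc =>
    hij (hE.disjoint i hi j hj c hc ⟨d, hd, hdc⟩)
  have h1 := h.comp_right hd hdc (h.strictMonoOn_or_strictAntiOn_iterate hf hE.ordConnected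
    (fun i hi => hcE i (by omega) (by omega)))
  rw [← Function.iterate_succ'] at h1
  have hc2 : (f^[j.succ] '' E).OrdConnected :=
    (hE.ordConnected.isPreconnected.image _ (hf.iterate _).continuousOn).ordConnected
  have h2 := h1.comp_left (g := f^[m - j.succ])
    (h.strictMonoOn_or_strictAntiOn_iterate hf hc2 fun i hi => by
      rw [← image_comp, ← Function.iterate_add]
      exact hcE _ (by omega) (by omega))
  rwa [← Function.iterate_add, Nat.sub_add_cancel (by omega)] at h2

theorem FoldOn.exists_eq_or_eq_of_apply_eq (h : FoldOn f univ c) (p : ℝ) :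
    ∃ q₁ q₂, ∀ q, f q = p → q = q₁ ∨ q = q₂ := by
  have hinj : InjOn f (Iic c) ∧ InjOn f (Ici c) := by
    rcases h with ⟨h1, h2⟩ | ⟨h1, h2⟩ <;> rw [univ_inter] at h1 h2 <;>
      exact ⟨h1.injOn, h2.injOn⟩
  have h1 : ∃ q₁, ∀ q ≤ c, f q = p → q = q₁ := by
    by_cases hq : ∃ q ≤ c, f q = p
    · obtain ⟨q₁, hq₁, hp⟩ := hq
      exact ⟨q₁, fun q hqc hqp => hinj.1 hqc hq₁ (hqp.trans hp.symm)⟩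
    · exact ⟨0, fun q hqc hqp => (hq ⟨q, hqc, hqp⟩).elim⟩
  have h2 : ∃ q₂, ∀ q, c ≤ q → f q = p → q = q₂ := by
    by_cases hq : ∃ q, c ≤ q ∧ f q = p
    · obtain ⟨q₂, hq₂, hp⟩ := hq
      exact ⟨q₂, fun q hqc hqp => hinj.2 hqc hq₂ (hqp.trans hp.symm)⟩
    · exact ⟨0, fun q hqc hqp => (hq ⟨q, hqc, hqp⟩).elim⟩
  obtain ⟨q₁, h1⟩ := h1
  obtain ⟨q₂, h2⟩ := h2
  exact ⟨q₁, q₂, fun q hq => (le_total q c).imp (fun h => h1 q h hq) fun h => h2 q h hq⟩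

end Fold

section Core

variable {f : ℝ → ℝ} {x y c : ℝ}

/-- A point with backward orbits in every `reach f y ε` has one lying in all of them. -/
theorem exists_backOrbit_mem_iInter_reach (h : FoldOn f univ c)
    (H : ∀ ε > 0, ∃ z, BackOrbit f x z ∧ ∀ n, z n ∈ reach f y ε) :
    ∃ z, BackOrbit f x z ∧ ∀ n, ∀ ε > 0, z n ∈ reach f y ε := by
  let G : Set ℝ := {p | ∀ ε > 0, ∃ z, BackOrbit f p z ∧ ∀ n, z n ∈ reach f y ε}
  have step : ∀ p : G, ∃ q : G, f q = p := by
    rintro ⟨p, hp⟩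
    by_contra! hcon
    obtain ⟨q₁, q₂, hq⟩ := h.exists_eq_or_eq_of_apply_eq p
    have hfail : ∀ q, f q = p → ∃ ε > 0, ∀ ε' ≤ ε, ∀ z, BackOrbit f q z →
        ∃ n, z n ∉ reach f y ε' := by
      intro q hqp
      have hqG : q ∉ G := fun hqG => hcon ⟨q, hqG⟩ hqp
      simp only [G, mem_ofPred_eq] at hqG
      push Not at hqG
      obtain ⟨ε, hε, hz⟩ := hqG
      refine ⟨ε, hε, fun ε' hε' z hbz => ?_⟩
      obtain ⟨n, hn⟩ := hz z hbz
      exact ⟨n, fun hn' => hn (reach_mono hε' hn')⟩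
    have hfail' : ∀ q, ∃ ε > 0, f q = p → ∀ ε' ≤ ε, ∀ z, BackOrbit f q z →
        ∃ n, z n ∉ reach f y ε' := by
      intro q
      by_cases hqp : f q = p
      · obtain ⟨ε, hε, h⟩ := hfail q hqp
        exact ⟨ε, hε, fun _ => h⟩
      · exact ⟨1, one_pos, fun h => (hqp h).elim⟩
    obtain ⟨ε₁, hε₁, h₁⟩ := hfail' q₁
    obtain ⟨ε₂, hε₂, h₂⟩ := hfail' q₂
    obtain ⟨z, hz, hzW⟩ := hp (min ε₁ ε₂) (lt_min hε₁ hε₂)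
    have hz1 : f (z 1) = p := (hz.2 0).trans hz.1
    rcases hq _ hz1 with h | h
    · obtain ⟨n, hn⟩ := h₁ (h ▸ hz1) _ (min_le_left _ _) _ (h ▸ hz.tail)
      exact hn (hzW _)
    · obtain ⟨n, hn⟩ := h₂ (h ▸ hz1) _ (min_le_right _ _) _ (h ▸ hz.tail)
      exact hn (hzW _)
  choose s hs using step
  let w : ℕ → G := fun n => s^[n] ⟨x, H⟩
  refine ⟨fun n => w n, ⟨rfl, fun n => ?_⟩, fun n ε hε => ?_⟩
  · simp only [w, Function.iterate_succ_apply', hs]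
  · obtain ⟨z, hz, hzW⟩ := (w n).2 ε hε
    have := hzW 0
    rwa [hz.1] at this

/-- The case in which the sets `reach f y ε` stabilize. -/
theorem exists_clusterPt_of_Ioo_subset_reach {δ : ℝ} (hδ : 0 < δ)
    (hU : ∀ ε > 0, Ioo y (y + δ) ⊆ reach f y ε) (hx : x ∈ reach f y δ) :
    ∃ z, BackOrbit f x z ∧ MapClusterPt y atTop z := by
  have hstep : ∀ (n : ℕ) (p : reach f y δ), ∃ q : reach f y δ,
      (q : ℝ) ∈ Ioo y (y + 1 / ((n : ℝ) + 1)) ∧ ∃ k, 1 ≤ k ∧ f^[k] q = p := by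
    rintro n ⟨p, hp⟩
    have hn : 0 < 1 / ((n : ℝ) + 1) := Nat.one_div_pos_of_nat
    obtain ⟨η, hη, hηδ, hηn, hpη⟩ :
        ∃ η > 0, η ≤ δ ∧ η ≤ 1 / ((n : ℝ) + 1) ∧ p ∉ Ioo y (y + η) := by
      have hmin := lt_min hδ hn
      rcases le_or_gt p y with h | h
      · exact ⟨_, hmin, min_le_left _ _, min_le_right _ _, fun hp => (hp.1.trans_le h).false⟩
      · refine ⟨min (min δ (1 / ((n : ℝ) + 1))) (p - y), lt_min hmin (sub_pos.2 h),
          (min_le_left _ _).trans (min_le_left _ _), (min_le_left _ _).trans (min_le_right _ _),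
          fun hp => ?_⟩
        have := min_le_right (min δ (1 / ((n : ℝ) + 1))) (p - y)
        linarith [hp.2]
    obtain ⟨k, u, hu, hk⟩ : p ∈ reach f y η := by
      obtain ⟨k, u, hu, rfl⟩ := hp
      exact iterate_mem_reach (hU _ hη hu) k
    refine ⟨⟨u, Ioo_subset_reach ⟨hu.1, by linarith [hu.2]⟩⟩, ⟨hu.1, by linarith [hu.2]⟩, k,
      Nat.one_le_iff_ne_zero.2 ?_, hk⟩
    rintro rfl
    exact hpη (by rwa [← hk])
  choose s hs hsk using hstep
  obtain ⟨Y, hY_zero, hY_succ⟩ : ∃ Y : ℕ → reach f y δ,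
      Y 0 = ⟨x, hx⟩ ∧ ∀ n, Y (n + 1) = s n (Y n) :=
    ⟨fun n => Nat.rec (motive := fun _ => ↥(reach f y δ)) ⟨x, hx⟩ s n, rfl, fun _ => rfl⟩
  have hY : ∀ n, ∃ k, 1 ≤ k ∧ f^[k] (Y (n + 1) : ℝ) = (Y n : ℝ) := by
    intro n
    rw [hY_succ]
    exact hsk n (Y n)
  refine exists_backOrbit_of_chain (Y := fun n => (Y n : ℝ)) (by simp [hY_zero]) hY ?_
  rw [← tendsto_add_atTop_iff_nat 1]
  refine tendsto_of_tendsto_of_tendsto_of_le_of_le tendsto_const_nhds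
    (by simpa using tendsto_one_div_add_atTop_nhds_zero_nat.const_add y)
    (fun n => ?_) (fun n => ?_)
  · simpa only [hY_succ] using (hs n (Y n)).1.le
  · simpa only [hY_succ, one_div] using (hs n (Y n)).2.le

/-- Points of `E` reached from ever smaller neighbourhoods of `y` are not to the right of `y`. -/
def Trapped (f : ℝ → ℝ) (y : ℝ) (E : Set ℝ) : Prop :=
  ∀ δ > 0, ∃ ε > 0, ∀ w ∈ reach f y ε, w ∈ E → w < y + δ

variable {ε : ℝ} {E : Set ℝ} {m : ℕ}

theorem Trapped.le (h : Trapped f y E) {w : ℝ} (hw : ∀ ε > 0, w ∈ reach f y ε) (hwE : w ∈ E) :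
    w ≤ y :=
  le_of_forall_pos_lt_add fun δ hδ => by
    obtain ⟨ε, hε, h⟩ := h δ hδ
    exact h w (hw ε hε) hwE

theorem ReachCycle.lt_of_not_subset (hE : ReachCycle f y ε E m) (hε : 0 < ε) {δ : ℝ}
    (h : ¬ Ioo y (y + δ) ⊆ reach f y ε) {p : ℝ} (hp : p ∈ E) : p < y + δ := by
  obtain ⟨q, hq, hqW⟩ := not_subset.1 h
  by_contra! hpδ
  have hqε : y + ε ≤ q := not_lt.1 fun hlt => hqW (Ioo_subset_reach ⟨hq.1, hlt⟩)
  have hu : y + ε / 2 ∈ E := hE.Ioo_subset ⟨by linarith, by linarith⟩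
  exact hqW (hE.subset_reach (hE.ordConnected.out hu hp ⟨by linarith, by linarith [hq.2]⟩))

theorem exists_trapped_reachCycle (hf : Continuous f)
    (hcyc : ∀ ε > 0, ∃ E m, ReachCycle f y ε E m)
    {z : ℕ → ℝ} (hz : BackOrbit f x z) (hzQ : ∀ n, ∀ ε > 0, z n ∈ reach f y ε)
    (hcl : ¬ MapClusterPt y atTop z)
    (hU : ∀ δ > 0, ∃ ε > 0, ¬ Ioo y (y + δ) ⊆ reach f y ε) {ε₁ : ℝ} (hε₁ : 0 < ε₁) :
    ∃ ε, 0 < ε ∧ ε ≤ ε₁ ∧ ∃ E m, ReachCycle f y ε E m ∧ Trapped f y E := by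
  have hsmall : ∀ δ > 0, ∀ ε' > 0, ∃ ε, 0 < ε ∧ ε ≤ ε' ∧ ∃ E m, ReachCycle f y ε E m ∧
      ∀ p ∈ E, p < y + δ := by
    intro δ hδ ε' hε'
    obtain ⟨ε, hε, h⟩ := hU δ hδ
    obtain ⟨E, m, hE⟩ := hcyc (min ε ε') (lt_min hε hε')
    exact ⟨_, lt_min hε hε', min_le_right _ _, E, m, hE, fun p hp =>
      hE.lt_of_not_subset (lt_min hε hε') (fun hs => h (hs.trans (reach_mono (min_le_left _ _))))
        hp⟩
  obtain ⟨η, hη, N, hN⟩ : ∃ η > 0, ∃ N, ∀ n ≥ N, z n ∉ Ioo y (y + η) := by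
    rw [mapClusterPt_iff_frequently] at hcl
    push Not at hcl
    obtain ⟨s, hs, hzs⟩ := hcl
    obtain ⟨η, hη, hball⟩ := Metric.mem_nhds_iff.1 hs
    obtain ⟨N, hN⟩ := eventually_atTop.1 hzs
    refine ⟨η, hη, N, fun n hn hmem => hN n hn (hball ?_)⟩
    rw [Metric.mem_ball, Real.dist_eq, abs_lt]
    constructor <;> linarith [hmem.1, hmem.2]
  obtain ⟨ε, hε, hε1, E, m, hE, hEη⟩ := hsmall η hη ε₁ hε₁
  refine ⟨ε, hε, hε1, E, m, hE, fun δ hδ => ?_⟩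
  obtain ⟨ε', hε', hεε', E', m', hE', hEδ⟩ := hsmall δ hδ ε hε
  refine ⟨ε', hε', fun w hw hwE => ?_⟩
  by_contra! hwδ
  obtain ⟨j, hj, hwj⟩ := hE'.cover w hw
  have hconn : (f^[j] '' E').OrdConnected :=
    (hE'.ordConnected.isPreconnected.image _ (hf.iterate j).continuousOn).ordConnected
  have hsub : f^[j] '' E' ⊆ E := by
    refine hE.maximal _ hconn ?_ ⟨w, hwj, hwE⟩
    rintro _ ⟨q, hq, rfl⟩
    exact reach_mono hεε' (iterate_mem_reach (hE'.subset_reach hq) j)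
  have hu : y + ε' / 2 ∈ E' := hE'.Ioo_subset ⟨by linarith, by linarith⟩
  obtain ⟨n, hn, hnj⟩ := hE'.exists_mem_image hz (fun n => hzQ n ε' hε') hj N
  refine hN n hn ⟨?_, hEη _ (hsub hnj)⟩
  by_contra! hle
  have huj : y + ε' / 2 ∈ f^[j] '' E' :=
    hconn.out hnj hwj ⟨by linarith, by linarith [hEδ _ hu]⟩
  obtain rfl : 0 = j := hE'.disjoint 0 hE'.period_pos j hj _ ⟨_, hu, rfl⟩ huj
  obtain ⟨q, hq, rfl⟩ := hwj
  exact (hEδ q hq).not_ge hwδ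

theorem exists_clusterPt_of_iterate_eq {N q : ℕ} (hN : 0 < N) (hy : f^[N] y = y)
    (hq : f^[q] y = x) : ∃ z, BackOrbit f x z ∧ MapClusterPt y atTop z := by
  refine exists_backOrbit_of_chain (Y := fun n => if n = 0 then x else y) (by simp) ?_
    (tendsto_const_nhds.congr' ?_)
  · rintro (_ | n)
    · refine ⟨q + N, by omega, ?_⟩
      simp [Function.iterate_add_apply, hy, hq]
    · exact ⟨N, hN, by simpa using hy⟩
  · filter_upwards [eventually_ne_atTop 0] with n hn
    simp [hn]

/-- If an iterate of `f` is increasing to the right of `y` and brings points back there, then `y`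
is periodic and `x` lies in its orbit. -/
theorem ReachCycle.exists_clusterPt_of_strictMonoOn (hf : Continuous f)
    (hx : ∀ ε > 0, x ∈ reach f y ε) (hε : 0 < ε) (hE : ReachCycle f y ε E m)
    (htr : Trapped f y E) {N : ℕ} (hN : 0 < N) (hmap : MapsTo f^[N] E E) {A : Set ℝ}
    (hA : ∀ p ∈ A, ∀ q ∈ E, p ≤ q → q ∈ A) (hmono : StrictMonoOn f^[N] A)
    (hret : ∀ ε' > 0, ε' ≤ ε → ∃ t ∈ A, t ∈ E ∧ t ∈ reach f y ε' ∧ y < f^[N] t) :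
    ∃ z, BackOrbit f x z ∧ MapClusterPt y atTop z := by
  have hgt : ∀ u ∈ Ioo y (y + ε), y < f^[N] u := by
    intro u hu
    obtain ⟨ε', hε', h⟩ := htr (u - y) (sub_pos.2 hu.1)
    obtain ⟨t, htA, htE, htW, hty⟩ := hret (min ε' ε) (lt_min hε' hε) (min_le_right _ _)
    have htu : t < u := by
      have := h t (reach_mono (min_le_left _ _) htW) htE
      linarith
    exact hty.trans (hmono htA (hA t htA u (hE.Ioo_subset hu) htu.le) htu)
  have hlim : Tendsto f^[N] (𝓝[>] y) (𝓝 (f^[N] y)) :=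
    (hf.iterate N).continuousAt.tendsto.mono_left nhdsWithin_le_nhds
  have hIoo : ∀ δ > 0, ∀ᶠ u in 𝓝[>] y, u ∈ Ioo y (y + δ) := fun δ hδ =>
    Ioo_mem_nhdsGT (by linarith)
  have hfix : f^[N] y = y := by
    refine le_antisymm (le_of_forall_pos_le_add fun δ hδ => ?_) ?_
    · obtain ⟨ε', hε', h⟩ := htr δ hδ
      refine le_of_tendsto hlim ?_
      filter_upwards [hIoo ε hε, hIoo ε' hε'] with u hu hu'
      exact (h _ (iterate_mem_reach (Ioo_subset_reach hu') N) (hmap (hE.Ioo_subset hu))).le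
    · refine ge_of_tendsto hlim ?_
      filter_upwards [hIoo ε hε] with u hu
      exact (hgt u hu).le
  have hnear : ∀ δ > 0, δ ≤ ε → ∃ w ∈ Ioo y (y + δ), ∃ q < N, f^[q] w = x := by
    intro δ hδ hδε
    obtain ⟨ε', hε', h⟩ := htr δ hδ
    have hm := lt_min hε' hδ
    obtain ⟨k, u, hu, hk⟩ := hx (min ε' δ) hm
    have hstay : ∀ j, (f^[N])^[j] u ∈ Ioo y (y + δ) := by
      intro j
      induction j with
      | zero => exact ⟨hu.1, hu.2.trans_le (by linarith [min_le_right ε' δ])⟩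
      | succ j ih =>
        have ih' : (f^[N])^[j] u ∈ Ioo y (y + ε) := ⟨ih.1, by linarith [ih.2]⟩
        rw [Function.iterate_succ_apply']
        refine ⟨hgt _ ih', h _ ?_ (hmap (hE.Ioo_subset ih'))⟩
        rw [← Function.iterate_succ_apply' f^[N], ← Function.iterate_mul]
        exact reach_mono (min_le_left _ _) (iterate_mem_reach (Ioo_subset_reach hu) _)
    refine ⟨_, hstay (k / N), k % N, Nat.mod_lt _ hN, ?_⟩
    rw [← Function.iterate_mul, ← Function.iterate_add_apply, Nat.mod_add_div, hk]
  by_cases hq : ∃ q < N, f^[q] y = x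
  · obtain ⟨q, -, hq⟩ := hq
    exact exists_clusterPt_of_iterate_eq hN hfix hq
  · push Not at hq
    have hev : ∀ᶠ w in 𝓝 y, ∀ q ∈ Finset.range N, f^[q] w ≠ x := by
      rw [Filter.eventually_all_finset]
      exact fun q hqN => (hf.iterate q).continuousAt.eventually_ne (hq q (Finset.mem_range.1 hqN))
    obtain ⟨δ, hδ, hball⟩ := Metric.eventually_nhds_iff.1 hev
    obtain ⟨w, hw, q, hqN, hqx⟩ := hnear (min δ ε) (lt_min hδ hε) (min_le_right _ _)
    refine (hball ?_ q (Finset.mem_range.2 hqN) hqx).elim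
    rw [Real.dist_eq, abs_lt]
    constructor <;> linarith [hw.1, hw.2, min_le_left δ ε]

theorem ReachCycle.backOrbit_add_period_mem (hE : ReachCycle f y ε E m) {z : ℕ → ℝ}
    (hz : BackOrbit f x z) (hzW : ∀ n, z n ∈ reach f y ε) {n : ℕ} (hn : z n ∈ E) :
    z (n + m) ∈ E :=
  hE.mem_of_iterate_mem (hzW _) (by rwa [hz.iterate_add])

/-- A point accumulated from the right by the accumulation points of backward orbits of `x` is
itself an accumulation point of a backward orbit of `x`. -/
theorem exists_clusterPt_of_frequently_Ioo (hf : Continuous f) (hfold : FoldOn f univ c)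
    (H : ∀ ε > 0, ∃ z, BackOrbit f x z ∧ ∃ᶠ n in atTop, z n ∈ Ioo y (y + ε)) :
    ∃ z, BackOrbit f x z ∧ MapClusterPt y atTop z := by
  have hx : ∀ ε > 0, x ∈ reach f y ε := fun ε hε => by
    obtain ⟨z, hz, hzU⟩ := H ε hε
    exact hz.1 ▸ hz.mem_reach hzU 0
  obtain ⟨z, hz, hzQ⟩ := exists_backOrbit_mem_iInter_reach hfold fun ε hε => by
    obtain ⟨z, hz, hzU⟩ := H ε hε
    exact ⟨z, hz, hz.mem_reach hzU⟩
  by_cases hcl : MapClusterPt y atTop z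
  · exact ⟨z, hz, hcl⟩
  by_cases hU : ∃ δ > 0, ∀ ε > 0, Ioo y (y + δ) ⊆ reach f y ε
  · obtain ⟨δ, hδ, hU⟩ := hU
    exact exists_clusterPt_of_Ioo_subset_reach hδ hU (hx δ hδ)
  push Not at hU
  have htrap := fun ε₁ => exists_trapped_reachCycle hf
    (fun ε hε => (H ε hε).elim fun z hz => hz.1.exists_reachCycle hf hε hz.2)
    hz hzQ hcl hU (ε₁ := ε₁)
  by_cases hcQ : ∀ ε > 0, c ∈ reach f y ε
  · obtain ⟨ε, hε, -, E, m, hE, htr⟩ := htrap 1 one_pos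
    obtain ⟨j, hj, d, hd, hdc⟩ := hE.cover c (hcQ ε hε)
    have hv : f^[m] d = f^[m - j] c := by
      rw [← hdc, ← Function.iterate_add_apply, Nat.sub_add_cancel hj.le]
    have hvQ : ∀ ε' > 0, f^[m] d ∈ reach f y ε' := fun ε' hε' =>
      hv ▸ iterate_mem_reach (hcQ ε' hε') _
    have hvE : f^[m] d ∈ E := hE.mapsTo hd
    have hvy : f^[m] d ≤ y := htr.le hvQ hvE
    have hgvy : f^[m] (f^[m] d) ≤ y :=
      htr.le (fun ε' hε' => iterate_mem_reach (hvQ ε' hε') m) (hE.mapsTo hvE)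
    rcases hE.foldOn hf hfold hj hd hdc with ⟨h1, h2⟩ | ⟨h1, h2⟩
    · obtain ⟨z, hz, hzU⟩ := H ε hε
      obtain ⟨n, hn⟩ := hzU.exists
      have ht := hE.backOrbit_add_period_mem hz (hz.mem_reach hzU) (hE.Ioo_subset hn)
      have hle : f^[m] (z (n + m)) ≤ f^[m] d := by
        rcases le_total (z (n + m)) d with hd' | hd'
        · exact h1.monotoneOn ⟨ht, hd'⟩ ⟨hd, self_mem_Iic⟩ hd'
        · exact h2.antitoneOn ⟨hd, self_mem_Ici⟩ ⟨ht, hd'⟩ hd'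
      rw [hz.iterate_add] at hle
      exact absurd hn.1 (hle.trans hvy).not_gt
    · refine hE.exists_clusterPt_of_strictMonoOn hf hx hε htr hE.period_pos hE.mapsTo
        (A := E ∩ Ici d) (fun p hp q hq hpq => ⟨hq, le_trans hp.2 hpq⟩) h2 fun ε' hε' hε'ε => ?_
      obtain ⟨z, hz, hzU⟩ := H ε' hε'
      have hzW := hz.mem_reach hzU
      have hzWε : ∀ n, z n ∈ reach f y ε := fun n => reach_mono hε'ε (hzW n)
      obtain ⟨n, hn⟩ := hzU.exists
      have hnE : z n ∈ E := hE.Ioo_subset ⟨hn.1, by linarith [hn.2]⟩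
      have ht := hE.backOrbit_add_period_mem hz hzWε hnE
      have ht' := hE.backOrbit_add_period_mem hz hzWε ht
      have hge : f^[m] d ≤ z (n + m) := by
        rw [← hz.iterate_add m (n + m)]
        rcases le_total (z (n + m + m)) d with hd' | hd'
        · exact h1.antitoneOn ⟨ht', hd'⟩ ⟨hd, self_mem_Iic⟩ hd'
        · exact h2.monotoneOn ⟨hd, self_mem_Ici⟩ ⟨ht', hd'⟩ hd'
      have htn : f^[m] (z (n + m)) = z n := hz.iterate_add m n
      refine ⟨z (n + m), ⟨ht, ?_⟩, ht, hzW _, htn ▸ hn.1⟩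
      by_contra hlt
      have hlt : z (n + m) ≤ d := (not_le.1 hlt).le
      have := h1.antitoneOn ⟨hvE, hge.trans hlt⟩ ⟨ht, hlt⟩ hge
      rw [htn] at this
      exact absurd hn.1 (this.trans hgvy).not_gt
  · push Not at hcQ
    obtain ⟨ε₁, hε₁, hc⟩ := hcQ
    obtain ⟨ε, hε, hεε₁, E, m, hE, htr⟩ := htrap ε₁ hε₁
    have hmap : MapsTo f^[m + m] E E := by
      rw [Function.iterate_add]
      exact hE.mapsTo.comp hE.mapsTo
    have hmono : StrictMonoOn f^[m + m] E := by
      rw [Function.iterate_add]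
      rcases hfold.strictMonoOn_or_strictAntiOn_iterate hf hE.ordConnected (j := m) (by
        rintro i - ⟨q, hq, rfl⟩
        exact hc (reach_mono hεε₁ (iterate_mem_reach (hE.subset_reach hq) i))) with h | h
      · exact h.comp h hE.mapsTo
      · exact h.comp h hE.mapsTo
    refine hE.exists_clusterPt_of_strictMonoOn hf hx hε htr (Nat.add_pos_left hE.period_pos m)
      hmap (A := E) (fun _ _ q hq _ => hq) hmono fun ε' hε' hε'ε => ?_
    obtain ⟨z, hz, hzU⟩ := H ε' hε'
    have hzW := hz.mem_reach hzU
    have hzWε : ∀ n, z n ∈ reach f y ε := fun n => reach_mono hε'ε (hzW n)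
    obtain ⟨n, hn⟩ := hzU.exists
    have hnE : z n ∈ E := hE.Ioo_subset ⟨hn.1, by linarith [hn.2]⟩
    have ht := hE.backOrbit_add_period_mem hz hzWε (hE.backOrbit_add_period_mem hz hzWε hnE)
    rw [add_assoc] at ht
    exact ⟨_, ht, ht, hzW _, by rw [hz.iterate_add]; exact hn.1⟩

end Core

section Closed

variable {f : ℝ → ℝ} {x y c : ℝ}

theorem FoldOn.neg_comp_neg (h : FoldOn f univ c) : FoldOn (fun t => -f (-t)) univ (-c) := by
  simp only [FoldOn, univ_inter] at h ⊢
  have m1 : MapsTo (fun t : ℝ => -t) (Iic (-c)) (Ici c) := fun p hp =>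
    mem_Ici.2 (le_neg_of_le_neg (mem_Iic.1 hp))
  have m2 : MapsTo (fun t : ℝ => -t) (Ici (-c)) (Iic c) := fun p hp =>
    mem_Iic.2 (neg_le_of_neg_le (mem_Ici.1 hp))
  rcases h with ⟨h1, h2⟩ | ⟨h1, h2⟩
  · exact Or.inr ⟨fun p hp q hq hpq => neg_lt_neg (h2 (m1 hq) (m1 hp) (neg_lt_neg hpq)),
      fun p hp q hq hpq => neg_lt_neg (h1 (m2 hq) (m2 hp) (neg_lt_neg hpq))⟩
  · exact Or.inl ⟨fun p hp q hq hpq => neg_lt_neg (h2 (m1 hq) (m1 hp) (neg_lt_neg hpq)),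
      fun p hp q hq hpq => neg_lt_neg (h1 (m2 hq) (m2 hp) (neg_lt_neg hpq))⟩

theorem BackOrbit.neg {z : ℕ → ℝ} (h : BackOrbit f x z) :
    BackOrbit (fun t => -f (-t)) (-x) (fun n => -z n) :=
  ⟨congrArg _ h.1, fun n => by simp [h.2 n]⟩

theorem exists_clusterPt_of_frequently_Ioo_left (hf : Continuous f) (hfold : FoldOn f univ c)
    (H : ∀ ε > 0, ∃ z, BackOrbit f x z ∧ ∃ᶠ n in atTop, z n ∈ Ioo (y - ε) y) :
    ∃ z, BackOrbit f x z ∧ MapClusterPt y atTop z := by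
  obtain ⟨z, hz, hcl⟩ := exists_clusterPt_of_frequently_Ioo (f := fun t => -f (-t)) (x := -x)
    (y := -y) (by fun_prop) hfold.neg_comp_neg fun ε hε => by
      obtain ⟨z, hz, hzU⟩ := H ε hε
      exact ⟨_, hz.neg, hzU.mono fun n hn => ⟨neg_lt_neg hn.2, by linarith [hn.1]⟩⟩
  refine ⟨fun n => -z n, by simpa using hz.neg, ?_⟩
  have := hcl.continuousAt_comp (f := fun t : ℝ => -t) continuous_neg.continuousAt
  simpa [Function.comp_def] using this

/-- For a continuous fold of the line, the accumulation points of the backward orbits of a point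
form a closed set. -/
theorem isClosed_setOf_exists_clusterPt (hf : Continuous f) (hfold : FoldOn f univ c) (x : ℝ) :
    IsClosed {y | ∃ z, BackOrbit f x z ∧ MapClusterPt y atTop z} := by
  refine isClosed_of_closure_subset fun y hy => ?_
  have hnear : ∀ ε > 0, ∃ z, BackOrbit f x z ∧ ∃ᶠ n in atTop, z n ∈ Ioo (y - ε) (y + ε) := by
    intro ε hε
    obtain ⟨p, hpU, z, hz, hcl⟩ := mem_closure_iff.1 hy (Ioo (y - ε) (y + ε)) isOpen_Ioo
      ⟨by linarith, by linarith⟩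
    exact ⟨z, hz, mapClusterPt_iff_frequently.1 hcl _ (isOpen_Ioo.mem_nhds hpU)⟩
  by_cases heq : ∃ z, BackOrbit f x z ∧ ∃ᶠ n in atTop, z n = y
  · obtain ⟨z, hz, hzy⟩ := heq
    exact ⟨z, hz, mapClusterPt_iff_frequently.2 fun s hs =>
      hzy.mono fun n hn => hn ▸ mem_of_mem_nhds hs⟩
  by_cases hR : ∀ ε > 0, ∃ z, BackOrbit f x z ∧ ∃ᶠ n in atTop, z n ∈ Ioo y (y + ε)
  · exact exists_clusterPt_of_frequently_Ioo hf hfold hR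
  · push Not at hR
    obtain ⟨ε₁, hε₁, hR⟩ := hR
    refine exists_clusterPt_of_frequently_Ioo_left hf hfold fun ε hε => ?_
    obtain ⟨z, hz, hzU⟩ := hnear (min ε ε₁) (lt_min hε hε₁)
    have hne : ∀ᶠ n in atTop, z n ≠ y := not_frequently.1 fun h => heq ⟨z, hz, h⟩
    refine ⟨z, hz, (hzU.and_eventually (hne.and (hR z hz))).mono ?_⟩
    rintro n ⟨hn, hny, hnR⟩
    refine ⟨by linarith [hn.1, min_le_left ε ε₁], lt_of_le_of_ne (not_lt.1 fun hlt => ?_) hny⟩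
    exact hnR ⟨hlt, by linarith [hn.2, min_le_right ε ε₁]⟩

end Closed

section Extension

variable {a b c : ℝ} {f : ℝ → ℝ}

/-- The extension of `f` from `[a, b]` to the line with slope `1` to the left of `a` and slope `-1`
to the right of `b`. -/
noncomputable def lineExtend (f : ℝ → ℝ) (a b : ℝ) (t : ℝ) : ℝ :=
  f (max a (min b t)) + min (t - a) 0 - max (t - b) 0

theorem lineExtend_of_mem {t : ℝ} (ht : t ∈ Icc a b) : lineExtend f a b t = f t := by
  simp [lineExtend, ht.1, ht.2]

theorem iterate_lineExtend_of_mem (hmap : MapsTo f (Icc a b) (Icc a b)) {t : ℝ}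
    (ht : t ∈ Icc a b) (k : ℕ) : (lineExtend f a b)^[k] t = f^[k] t := by
  induction k generalizing t with
  | zero => rfl
  | succ k ih => rw [Function.iterate_succ_apply, Function.iterate_succ_apply,
      lineExtend_of_mem ht, ih (hmap ht)]

theorem continuous_lineExtend (hab : a ≤ b) (hf : ContinuousOn f (Icc a b)) :
    Continuous (lineExtend f a b) := by
  have h : Continuous fun t : ℝ => f (max a (min b t)) :=
    hf.comp_continuous (by fun_prop) fun t => ⟨le_max_left _ _, max_le hab (min_le_left _ _)⟩
  exact (h.add (by fun_prop)).sub (by fun_prop)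

theorem foldOn_lineExtend (hc : c ∈ Icc a b) (h1 : StrictMonoOn f (Icc a c))
    (h2 : StrictAntiOn f (Icc c b)) : FoldOn (lineExtend f a b) univ c := by
  refine Or.inl ⟨?_, ?_⟩
  · rintro p ⟨-, hp⟩ q ⟨-, hq⟩ hpq
    simp only [mem_Iic] at hp hq
    have hpb : p ≤ b := hp.trans hc.2
    have hqb : q ≤ b := hq.trans hc.2
    simp only [lineExtend, min_eq_right hpb, min_eq_right hqb,
      max_eq_right (sub_nonpos.2 hpb), max_eq_right (sub_nonpos.2 hqb)]
    rcases le_total a p with hap | hpa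
    · have := h1 ⟨hap, hp⟩ ⟨hap.trans hpq.le, hq⟩ hpq
      simpa [hap, hap.trans hpq.le] using this
    · have hle : f (max a p) ≤ f (max a q) :=
        h1.monotoneOn ⟨le_max_left _ _, max_le hc.1 hp⟩ ⟨le_max_left _ _, max_le hc.1 hq⟩
          (max_le_max_left a hpq.le)
      rcases le_total a q with haq | hqa
      · rcases hpa.eq_or_lt with rfl | hpa
        · have := h1 ⟨le_rfl, hp⟩ ⟨hpq.le, hq⟩ hpq
          simpa [hpq.le] using this
        · rw [min_eq_left (by linarith), min_eq_right (by linarith)]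
          linarith
      · rw [min_eq_left (by linarith), min_eq_left (by linarith)]
        linarith
  · rintro p ⟨-, hp⟩ q ⟨-, hq⟩ hpq
    simp only [mem_Ici] at hp hq
    have hpa : a ≤ p := hc.1.trans hp
    have hqa : a ≤ q := hc.1.trans hq
    have hab := hc.1.trans hc.2
    simp only [lineExtend, max_eq_right (le_min hab hpa), max_eq_right (le_min hab hqa),
      min_eq_right (sub_nonneg.2 hpa), min_eq_right (sub_nonneg.2 hqa)]
    rcases le_total q b with hqb | hbq
    · have := h2 ⟨hp, hpq.le.trans hqb⟩ ⟨hq, hqb⟩ hpq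
      simpa [hqb, hpq.le.trans hqb] using this
    · have hle : f (min b q) ≤ f (min b p) :=
        h2.antitoneOn ⟨le_min hc.2 hp, min_le_left _ _⟩ ⟨le_min hc.2 hq, min_le_left _ _⟩
          (min_le_min_left b hpq.le)
      rcases le_total p b with hpb | hbp
      · rcases hbq.eq_or_lt with rfl | hbq
        · have := h2 ⟨hp, hpq.le⟩ ⟨hq, le_rfl⟩ hpq
          simpa [hpq.le] using this
        · rw [max_eq_left (by linarith), max_eq_right (by linarith)]
          linarith
      · rw [max_eq_left (by linarith), max_eq_left (by linarith)]
        linarith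

theorem mem_Icc_of_lineExtend_mem (hab : a ≤ b) (ha : f a = a) (hb : f b = a) {t : ℝ}
    (ht : lineExtend f a b t ∈ Icc a b) : t ∈ Icc a b := by
  by_contra h
  rcases lt_or_ge t a with hta | hat
  · have : lineExtend f a b t = t := by
      rw [lineExtend, min_eq_right (by linarith), max_eq_left hta.le,
        min_eq_left (by linarith), max_eq_right (by linarith), ha]
      ring
    exact h (this ▸ ht)
  · have hbt : b < t := not_le.1 fun htb => h ⟨hat, htb⟩
    have : lineExtend f a b t = a - (t - b) := by
      rw [lineExtend, min_eq_left hbt.le, max_eq_right hab, min_eq_right (by linarith),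
        max_eq_left (by linarith), hb]
      ring
    linarith [ht.1]

end Extension

theorem SUnimodal.apply_left {a b c : ℝ} {f : ℝ → ℝ} (hf : SUnimodal f a b c) : f a = a := by
  rcases hf.fixed_endpoint with h | h
  · exact h
  · have hc := hf.c_mem
    have h1 : f a < f c := hf.mono ⟨le_rfl, hc.1.le⟩ ⟨hc.1.le, le_rfl⟩ hc.1
    have h2 := (hf.mapsTo ⟨hc.1.le, hc.2.le⟩).2
    rw [hf.endpoints_eq, h] at h1
    exact absurd h1 h2.not_gt

theorem SUnimodal.sAlphaOn_eq {a b c : ℝ} {f : ℝ → ℝ} (hf : SUnimodal f a b c) {x : ℝ}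
    (hx : x ∈ Icc a b) : sAlphaOn f (Icc a b) x =
      {y | ∃ z, BackOrbit (lineExtend f a b) x z ∧ MapClusterPt y atTop z} := by
  ext y
  constructor
  · rintro ⟨Y, k, h0, hY, hk, hlim⟩
    refine exists_backOrbit_of_chain h0 (fun n => ⟨k (n + 1), (hk (n + 1) (by omega)).1, ?_⟩) hlim
    rw [iterate_lineExtend_of_mem hf.mapsTo (hY _)]
    exact (hk (n + 1) (by omega)).2
  · rintro ⟨z, hz, hcl⟩
    have hzI : ∀ n, z n ∈ Icc a b := by
      intro n
      induction n with
      | zero => rwa [hz.1]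
      | succ n ih =>
        exact mem_Icc_of_lineExtend_mem hf.lt_ab.le hf.apply_left
          (hf.endpoints_eq ▸ hf.apply_left) (by rwa [hz.2])
    obtain ⟨φ, hφ, hlim⟩ := hcl.tendsto_subseq
    let ψ : ℕ → ℕ := fun n => if n = 0 then 0 else φ n
    have hψ : StrictMono ψ := strictMono_nat_of_lt_succ fun n => by
      rcases n with _ | n
      · simpa [ψ] using (Nat.zero_le _).trans_lt (hφ zero_lt_one)
      · simpa [ψ] using hφ (Nat.lt_succ_self (n + 1))
    refine ⟨z ∘ ψ, fun n => ψ n - ψ (n - 1), by simpa [ψ] using hz.1, fun n => hzI _,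
      fun n hn => ?_, hlim.congr' ?_⟩
    · have hlt : ψ (n - 1) < ψ n := hψ (by omega)
      refine ⟨Nat.sub_pos_of_lt hlt, ?_⟩
      simp only [Function.comp_apply]
      rw [← iterate_lineExtend_of_mem hf.mapsTo (hzI _)]
      have := hz.iterate_add (ψ n - ψ (n - 1)) (ψ (n - 1))
      rwa [Nat.add_sub_cancel' hlt.le] at this
    · filter_upwards [eventually_ne_atTop 0] with n hn
      simp [ψ, hn]

/-- For an S-unimodal map, all special α-limit sets of points are closed (the
Kolyada–Misiurewicz–Snoha conjecture for S-unimodal maps). -/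
theorem sAlpha_isClosed {a b c : ℝ} {f : ℝ → ℝ} (hf : SUnimodal f a b c) :
    ∀ x ∈ Icc a b, IsClosed (sAlphaOn f (Icc a b) x) := by
  intro x hx
  rw [hf.sAlphaOn_eq hx]
  exact isClosed_setOf_exists_clusterPt (continuous_lineExtend hf.lt_ab.le hf.smooth.continuousOn)
    (foldOn_lineExtend (Ioo_subset_Icc_self hf.c_mem) hf.mono hf.anti) x
end

section
/- For every μ ∈ (1,4) there exists δ > 0 such that for every x₀ ∈ (0,δ) the logistic map ℓ_μ(x) = μx(1−x) on [0,1] satisfies: (i) the α-limit set α(x₀) = ⋂_{n≥0} closure(⋃_{m≥n} ℓ_μ^{−m}(x₀)) equals {0,1}; (ii) every bitrajectory t of ℓ_μ based at x₀ satisfies t(−n) → 0 as n → ∞, so that sα(x₀) = {0}. In particular the special α-limit of x₀ is strictly smaller than its α-limit. -/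
open Set Filter Topology

/-- The logistic map `ℓ_μ(x) = μ x (1 - x)`. -/
def logistic (μ : ℝ) : ℝ → ℝ := fun x => μ * x * (1 - x)

/-- The α-limit set of `x` for `f` regarded as a map of the domain `D`:
`⋂_{n≥0} closure (⋃_{m≥n} f^{-m}(x))`. -/
def alphaLimOn (f : ℝ → ℝ) (D : Set ℝ) (x : ℝ) : Set ℝ :=
  ⋂ n : ℕ, closure (⋃ m, ⋃ (_ : n ≤ m), {z ∈ D | f^[m] z = x})

/-- The logistic map sends `[0,1]` into `[0, μ/4]`. -/
lemma logistic_mem_Icc {μ w : ℝ} (hμ : 1 < μ) (hw : w ∈ Icc (0 : ℝ) 1) :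
    logistic μ w ∈ Icc 0 (μ / 4) := by
  obtain ⟨h0, h1⟩ := hw
  refine ⟨mul_nonneg (by positivity) (by linarith), ?_⟩
  unfold logistic
  nlinarith [mul_nonneg (by linarith : (0 : ℝ) ≤ μ) (sq_nonneg (2 * w - 1))]

/-- A preimage in `[0, μ/4]` of a small positive point `x` is positive and smaller than `x`. -/
lemma pos_and_lt_of_logistic_eq {μ x z : ℝ} (hμ : 1 < μ) (hx : 0 < x)
    (hxc : x < logistic μ (μ / 4)) (hxp : 1 < μ * (1 - x))
    (hz : z ∈ Icc 0 (μ / 4)) (hzx : logistic μ z = x) : 0 < z ∧ z < x := by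
  obtain ⟨h0, hc⟩ := hz
  have hz0 : 0 < z := by
    rcases h0.eq_or_lt with rfl | h
    · simp [logistic] at hzx
      linarith
    · exact h
  refine ⟨hz0, ?_⟩
  by_contra! hle
  unfold logistic at hzx hxc
  have hz1 : z < 1 - μ / 4 := by
    by_contra! h
    nlinarith [mul_nonneg (by linarith : (0 : ℝ) ≤ μ)
      (mul_nonneg (sub_nonneg.2 hc) (sub_nonneg.2 h))]
  have ha : μ * (1 - z) ≤ 1 := by
    by_contra! h
    nlinarith [mul_pos hz0 (sub_pos.2 h)]
  have hs : 1 < μ * z := by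
    by_contra! h
    have := mul_nonneg (sub_nonneg.2 h) (sub_nonneg.2 ha)
    rw [← hzx] at hxp
    nlinarith
  nlinarith [sq_nonneg (μ - 2), mul_pos (by linarith : (0 : ℝ) < μ) (sub_pos.2 hz1)]

/-- Iterated preimages of a small point that are themselves images decay geometrically. -/
lemma iterate_preimage_bound {μ x₀ : ℝ} (hμ : μ ∈ Ioo (1 : ℝ) 4) (hx : 0 < x₀)
    (hxc : x₀ < logistic μ (μ / 4)) (hxp : 1 < μ * (1 - x₀)) (m : ℕ) :
    ∀ z ∈ logistic μ '' Icc 0 1, (logistic μ)^[m] z = x₀ →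
      0 < z ∧ z ≤ (μ * (1 - x₀))⁻¹ ^ m * x₀ := by
  obtain ⟨hμ1, hμ4⟩ := hμ
  induction m with
  | zero =>
    rintro z - rfl
    exact ⟨hx, by simp⟩
  | succ m ih =>
    rintro z ⟨w, hw, rfl⟩ h
    have hz := logistic_mem_Icc hμ1 hw
    set z := logistic μ w
    obtain ⟨hf0, hf⟩ := ih (logistic μ z) ⟨z, ⟨hz.1, by linarith [hz.2]⟩, rfl⟩ h
    have hq : (μ * (1 - x₀))⁻¹ ^ m ≤ 1 :=
      pow_le_one₀ (by positivity) (inv_le_one_of_one_le₀ hxp.le)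
    have hfx : logistic μ z ≤ x₀ := hf.trans (mul_le_of_le_one_left hx.le hq)
    obtain ⟨hz0, hzlt⟩ := pos_and_lt_of_logistic_eq hμ1 hf0 (hfx.trans_lt hxc)
      (by nlinarith) hz rfl
    refine ⟨hz0, ?_⟩
    have hmul : μ * (1 - x₀) * z ≤ logistic μ z := by
      have : 0 ≤ μ * z * (x₀ - z) :=
        mul_nonneg (by positivity) (by linarith)
      unfold logistic
      linarith
    rw [pow_succ', mul_assoc, inv_mul_eq_div, le_div_iff₀ (by linarith)]
    linarith

/-- A nonnegative point `x` with `x ≤ 1 - 1/μ` has a preimage in `[0, x]`. -/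
lemma exists_logistic_eq {μ x : ℝ} (hx : 0 ≤ x) (hxp : 1 ≤ μ * (1 - x)) :
    ∃ z ∈ Icc 0 x, logistic μ z = x := by
  have hcont : ContinuousOn (logistic μ) (Icc 0 x) := by
    unfold logistic
    fun_prop
  refine intermediate_value_Icc hx hcont ⟨by simpa [logistic] using hx, ?_⟩
  unfold logistic
  nlinarith

/-- A small point has a full backward orbit inside `[0, x₀]`. -/
lemma exists_backward_orbit {μ x₀ : ℝ} (hμ : 1 < μ) (hx : 0 ≤ x₀) (hxp : 1 ≤ μ * (1 - x₀)) :
    ∃ Y : ℕ → ℝ, Y 0 = x₀ ∧ (∀ n, Y n ∈ Icc 0 x₀) ∧ ∀ n, logistic μ (Y (n + 1)) = Y n := by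
  have hex : ∀ x : Icc 0 x₀, ∃ z : Icc 0 x₀, logistic μ z = x := by
    rintro ⟨x, h0, h1⟩
    obtain ⟨z, hz, h⟩ := exists_logistic_eq (μ := μ) h0 (by nlinarith)
    exact ⟨⟨z, hz.1, hz.2.trans h1⟩, h⟩
  choose g hg using hex
  refine ⟨fun n => g^[n] ⟨x₀, right_mem_Icc.2 hx⟩, rfl, fun n => Subtype.coe_prop _, fun n => ?_⟩
  simp only [Function.iterate_succ_apply', hg]

/-- Going back `n` steps along a backward orbit and then forward `n` steps is the identity. -/
lemma iterate_backward_orbit {f : ℝ → ℝ} {Y : ℕ → ℝ} (hY : ∀ n, f (Y (n + 1)) = Y n) (n : ℕ) :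
    f^[n] (Y n) = Y 0 := by
  induction n with
  | zero => rfl
  | succ n ih => rw [Function.iterate_succ_apply, hY, ih]

lemma logistic_one_sub (μ x : ℝ) : logistic μ (1 - x) = logistic μ x := by
  unfold logistic
  ring

/-- For every `μ ∈ (1,4)` there is `δ > 0` such that every `x₀ ∈ (0,δ)` has
α-limit set `{0,1}` under the logistic map, while every bitrajectory based at `x₀`
converges backward to `0`, so that `sα(x₀) = {0}`: the special α-limit is strictly
smaller than the α-limit. -/
theorem logistic_alpha_vs_sAlpha :
    ∀ μ : ℝ, μ ∈ Ioo (1 : ℝ) 4 → ∃ δ > (0 : ℝ), ∀ x₀ ∈ Ioo 0 δ,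
      alphaLimOn (logistic μ) (Icc 0 1) x₀ = {0, 1} ∧
      (∀ t : ℤ → ℝ, IsBitrajOn (logistic μ) (Icc 0 1) x₀ t →
        Tendsto (fun n : ℕ => t (-(n : ℤ))) atTop (𝓝 0)) ∧
      sAlphaOn (logistic μ) (Icc 0 1) x₀ = {0} := by
  rintro μ hμ
  obtain ⟨hμ1, hμ4⟩ := hμ
  have hμ0 : 0 < μ := by linarith
  refine ⟨min (logistic μ (μ / 4)) (1 - 1 / μ), lt_min ?_ ?_, ?_⟩
  · exact mul_pos (by positivity) (by linarith)
  · rw [sub_pos, div_lt_one hμ0]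
    exact hμ1
  rintro x₀ ⟨hx, hxδ⟩
  obtain ⟨hxc, hxp'⟩ := lt_min_iff.1 hxδ
  have hxp : 1 < μ * (1 - x₀) := by
    rw [mul_comm, ← div_lt_iff₀ hμ0]
    linarith
  have hx1 : x₀ < 1 := by
    by_contra! h
    nlinarith
  have bound := iterate_preimage_bound ⟨hμ1, hμ4⟩ hx hxc hxp
  have hlim : Tendsto (fun n : ℕ => (μ * (1 - x₀))⁻¹ ^ n * x₀) atTop (𝓝 0) := by
    simpa using (tendsto_pow_atTop_nhds_zero_of_lt_one (by positivity)
      (inv_lt_one_of_one_lt₀ hxp)).mul_const x₀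
  have hback : ∀ Y : ℕ → ℝ, Y 0 = x₀ → (∀ n, Y n ∈ Icc (0 : ℝ) 1) →
      (∀ n, logistic μ (Y (n + 1)) = Y n) → Tendsto Y atTop (𝓝 0) := by
    intro Y h0 hD hY
    have hb n := bound n (Y n) ⟨Y (n + 1), hD _, hY n⟩ ((iterate_backward_orbit hY n).trans h0)
    exact squeeze_zero (fun n => (hb n).1.le) (fun n => (hb n).2) hlim
  obtain ⟨Y, hY0, hYmem, hY⟩ := exists_backward_orbit hμ1 hx.le hxp.le
  have hYD : ∀ n, Y n ∈ Icc (0 : ℝ) 1 := fun n => ⟨(hYmem n).1, (hYmem n).2.trans hx1.le⟩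
  have hYlim := hback Y hY0 hYD hY
  have hYit n : (logistic μ)^[n] (Y n) = x₀ := (iterate_backward_orbit hY n).trans hY0
  refine ⟨?_, ?_, ?_⟩
  · apply Subset.antisymm
    · intro y hy
      have hmem : ∀ n : ℕ, y ∈ {z ∈ Icc (0 : ℝ) 1 |
          logistic μ z ≤ (μ * (1 - x₀))⁻¹ ^ n * x₀} := by
        intro n
        have hcont : Continuous (logistic μ) := by
          unfold logistic
          fun_prop
        refine closure_minimal ?_ (isClosed_Icc.inter (isClosed_le hcont continuous_const))
          (mem_iInter.1 hy (n + 1))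
        simp only [iUnion_subset_iff]
        rintro m hm z ⟨hz, h⟩
        obtain ⟨k, rfl⟩ : ∃ k, m = k + 1 := ⟨m - 1, by omega⟩
        refine ⟨hz, (bound k _ ⟨z, hz, rfl⟩ h).2.trans ?_⟩
        exact mul_le_mul_of_nonneg_right (pow_le_pow_of_le_one (by positivity)
          (inv_le_one_of_one_le₀ hxp.le) (by omega)) hx.le
      have hle : logistic μ y ≤ 0 := ge_of_tendsto' hlim fun n => (hmem n).2
      have heq : logistic μ y = 0 := hle.antisymm (logistic_mem_Icc hμ1 (hmem 0).1).1
      simp only [logistic, mul_eq_zero, hμ0.ne', false_or, sub_eq_zero] at heq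
      exact heq.imp id Eq.symm
    · rintro y (rfl | rfl) <;> refine mem_iInter.2 fun n => ?_
      · refine mem_closure_of_tendsto hYlim ((eventually_ge_atTop n).mono fun m hm => ?_)
        exact mem_iUnion₂.2 ⟨m, hm, hYD m, hYit m⟩
      · have hlim' : Tendsto (fun m => 1 - Y m) atTop (𝓝 1) := by
          simpa using hYlim.const_sub 1
        refine mem_closure_of_tendsto hlim' ((eventually_ge_atTop (n + 1)).mono fun m hm => ?_)
        refine mem_iUnion₂.2 ⟨m, by omega, ⟨by linarith [(hYD m).2], by linarith [(hYD m).1]⟩, ?_⟩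
        obtain ⟨k, rfl⟩ : ∃ k, m = k + 1 := ⟨m - 1, by omega⟩
        rw [Function.iterate_succ_apply, logistic_one_sub, ← Function.iterate_succ_apply, hYit]
  · rintro t ⟨h0, hD, ht⟩
    refine hback _ (by simpa using h0) (fun n => hD _) fun n => ?_
    rw [ht]
    congr 1
    push_cast
    ring
  · apply Subset.antisymm
    · rintro y ⟨Z, k, hZ0, hZD, hZ, hZlim⟩
      have hit : ∀ n, ∃ K, n ≤ K ∧ (logistic μ)^[K] (Z n) = x₀ := by
        intro n
        induction n with
        | zero => exact ⟨0, le_rfl, hZ0⟩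
        | succ n ih =>
          obtain ⟨K, hK, h⟩ := ih
          obtain ⟨hk, hs⟩ := hZ (n + 1) (by omega)
          refine ⟨K + k (n + 1), by omega, ?_⟩
          rw [Function.iterate_add_apply, hs]
          exact h
      have hmaps : MapsTo (logistic μ) (Icc 0 1) (Icc 0 1) := fun w hw =>
        Icc_subset_Icc_right (by linarith) (logistic_mem_Icc hμ1 hw)
      have himg : ∀ n, Z n ∈ logistic μ '' Icc 0 1 := by
        intro n
        obtain ⟨hk, hs⟩ := hZ (n + 1) (by omega)
        obtain ⟨j, hj⟩ : ∃ j, k (n + 1) = j + 1 := ⟨k (n + 1) - 1, by omega⟩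
        rw [hj, Function.iterate_succ_apply'] at hs
        exact ⟨_, hmaps.iterate j (hZD (n + 1)), hs⟩
      choose K hK hKit using hit
      have hb n := bound (K n) (Z n) (himg n) (hKit n)
      refine tendsto_nhds_unique hZlim (squeeze_zero (fun n => (hb n).1.le)
        (fun n => (hb n).2.trans ?_) hlim)
      exact mul_le_mul_of_nonneg_right (pow_le_pow_of_le_one (by positivity)
        (inv_le_one_of_one_le₀ hxp.le) (hK n)) hx.le
    · rintro y rfl
      refine ⟨Y, fun _ => 1, hY0, hYD, fun n hn => ⟨le_rfl, ?_⟩, hYlim⟩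
      obtain ⟨j, rfl⟩ : ∃ j, n = j + 1 := ⟨n - 1, by omega⟩
      exact hY j
end
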